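/- arXiv:1411.3285 — 2 statements merged into one kernel-verified Lean document; each statement's English description precedes it below -/
import Mathlib

section
/- Let f : ℝ² → ℝ be three times continuously differentiable and x₀ a point with ∇f(x₀) ≠ 0, and let β > 0. Define the L∞ amoeba distance on f by d(p,q) = infimum, over all piecewise C¹ curves c : [0,1] → ℝ² joining p to q, of ∫₀¹ max{‖c'(t)‖, β |(f∘c)'(t)|} dt, and let A_ρ(f; x₀) = { y : d(x₀,y) ≤ ρ }. For each ρ > 0 let m(ρ) be any median of f on A_ρ(f; x₀). Then, as ρ → 0⁺, m(ρ) = f(x₀) + (ρ²/6)·[|∇f| div(g_∞(|∇f|) ∇f/|∇f|)](x₀) + o(ρ²), where g_∞(z) = 1 for βz ≤ 1 and g_∞(z) = 1 − (1 − 1/(β² z²))^{3/2} for βz > 1. -/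
open MeasureTheory Asymptotics Filter Topology

noncomputable section

abbrev Plane := EuclideanSpace ℝ (Fin 2)

/-- `m` is a median of `u` on the set `A`. -/
def IsMedian (u : Plane → ℝ) (A : Set Plane) (m : ℝ) : Prop :=
  volume {x ∈ A | u x < m} ≤ volume A / 2 ∧ volume {x ∈ A | m < u x} ≤ volume A / 2

/-- a piecewise C¹ curve on [0,1] -/
def PiecewiseC1 (c : ℝ → Plane) : Prop :=
  ContinuousOn c (Set.Icc 0 1) ∧
  ∃ (n : ℕ) (t : ℕ → ℝ), t 0 = 0 ∧ t n = 1 ∧ (∀ i < n, t i < t (i + 1)) ∧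
    ∀ i < n, ContDiffOn ℝ 1 c (Set.Icc (t i) (t (i + 1)))

/-- the L∞ amoeba distance on the image `f`:
d(p,q) = inf over piecewise C¹ curves of ∫₀¹ max{‖c'(t)‖, β|(f∘c)'(t)|} dt -/
def amoebaDistLinf (β : ℝ) (f : Plane → ℝ) (p q : Plane) : ℝ :=
  sInf {L | ∃ c : ℝ → Plane, PiecewiseC1 c ∧ c 0 = p ∧ c 1 = q ∧
    L = ∫ t in (0:ℝ)..1, max ‖deriv c t‖ (β * |deriv (f ∘ c) t|)}

/-- the L∞ amoeba of radius ρ around x₀ -/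
def amoebaLinf (β : ℝ) (f : Plane → ℝ) (x₀ : Plane) (ρ : ℝ) : Set Plane :=
  {y | amoebaDistLinf β f x₀ y ≤ ρ}

/-- divergence of a planar vector field -/
def div2 (V : Plane → Plane) (x : Plane) : ℝ :=
  ∑ i : Fin 2, fderiv ℝ (fun y => V y i) x (EuclideanSpace.single i 1)

/-- the edge-stopping function of the L∞ amoeba metric -/
def gLinf (β : ℝ) (z : ℝ) : ℝ :=
  if β * z ≤ 1 then 1 else 1 - (1 - 1 / (β ^ 2 * z ^ 2)) ^ ((3:ℝ) / 2)


/-- The binary quadratic form with coefficients `N`, `M`, `T`, halved. -/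
def halfQuad (N M T x y : ℝ) : ℝ := (N * x ^ 2 + 2 * M * x * y + T * y ^ 2) / 2

lemma abs_halfQuad_le (N M T ξ : ℝ) {y : ℝ} (hy : |y| ≤ 1) :
    |halfQuad N M T ξ y| ≤ (|N| * ξ ^ 2 + 2 * |M| * |ξ| + |T|) / 2 := by
  have hy2 : y ^ 2 ≤ 1 := (sq_le_one_iff_abs_le_one y).2 hy
  unfold halfQuad
  rw [abs_div, abs_two]
  gcongr
  calc |N * ξ ^ 2 + 2 * M * ξ * y + T * y ^ 2|
      ≤ |N * ξ ^ 2| + |2 * M * ξ * y| + |T * y ^ 2| := abs_add_three _ _ _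
    _ = |N| * ξ ^ 2 + 2 * |M| * |ξ| * |y| + |T| * y ^ 2 := by
      simp only [abs_mul, abs_two, abs_pow, sq_abs]
    _ ≤ |N| * ξ ^ 2 + 2 * |M| * |ξ| * 1 + |T| * 1 := by gcongr
    _ = _ := by ring

lemma abs_halfQuad_sub_le (N M T ξ : ℝ) {x y : ℝ} (hx : |x| ≤ 1) (hy : |y| ≤ 1) :
    |halfQuad N M T x y - halfQuad N M T ξ y| ≤
      (|N| * (1 + |ξ|) + 2 * |M|) / 2 * |x - ξ| := by
  have h : halfQuad N M T x y - halfQuad N M T ξ y =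
      (N * (x + ξ) + 2 * M * y) / 2 * (x - ξ) := by unfold halfQuad; ring
  rw [h, abs_mul, abs_div, abs_two]
  gcongr
  calc |N * (x + ξ) + 2 * M * y| ≤ |N * (x + ξ)| + |2 * M * y| := abs_add_le _ _
    _ = |N| * |x + ξ| + 2 * |M| * |y| := by simp only [abs_mul, abs_two]
    _ ≤ |N| * (|x| + |ξ|) + 2 * |M| * 1 := by gcongr; exact abs_add_le _ _
    _ ≤ _ := by rw [mul_one]; gcongr

/-- First-order inversion of `x ↦ z x + ρ q(x, y) + O(ρ²)` near a reference point `ξ`. -/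
lemma exists_level_bounds {z : ℝ} (hz : 0 < z) (N M T ξ c K : ℝ) :
    ∃ K₀ > 0, ∀ᶠ ρ in 𝓝[>] (0 : ℝ), ∀ K₁ ≥ K₀, ∀ x y F : ℝ, x ^ 2 + y ^ 2 ≤ 1 →
      |F - z * x - ρ * halfQuad N M T x y| ≤ K * ρ ^ 2 →
      (x ≤ ξ + ρ / z * (c - halfQuad N M T ξ y) - K₁ * ρ ^ 2 → F < z * ξ + ρ * c) ∧
      (ξ + ρ / z * (c - halfQuad N M T ξ y) + K₁ * ρ ^ 2 ≤ x → z * ξ + ρ * c < F) := by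
  set A := (|N| * (1 + |ξ|) + 2 * |M|) / 2 with hA
  set Q := (|N| * ξ ^ 2 + 2 * |M| * |ξ| + |T|) / 2 with hQ
  have hA0 : 0 ≤ A := by positivity
  have hQ0 : 0 ≤ Q := by positivity
  set B := A / z * (|c| + Q) + |K| with hB
  have hB0 : 0 ≤ B := by positivity
  refine ⟨(2 * B + 1) / z, by positivity, ?_⟩
  have hlim : ∀ᶠ ρ in 𝓝[>] (0 : ℝ), ρ < z / (2 * A + 1) :=
    eventually_nhdsWithin_of_eventually_nhds (eventually_lt_nhds (by positivity))
  filter_upwards [hlim, self_mem_nhdsWithin] with ρ hρ hρ0 K₁ hK₁ x y F hxy hF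
  have hρ0 : 0 < ρ := hρ0
  have hx : |x| ≤ 1 := (sq_le_one_iff_abs_le_one x).1 (by nlinarith [sq_nonneg y])
  have hy : |y| ≤ 1 := (sq_le_one_iff_abs_le_one y).1 (by nlinarith [sq_nonneg x])
  have h1 := abs_halfQuad_sub_le N M T ξ hx hy
  have h2 := abs_halfQuad_le N M T ξ hy
  rw [← hA] at h1
  rw [← hQ] at h2
  set a := halfQuad N M T x y
  set b := halfQuad N M T ξ y
  set D := z * (x - ξ) - ρ * (c - b) with hD
  have hρA : ρ * (A / z) ≤ 1 / 2 := by
    rw [lt_div_iff₀ (by positivity)] at hρ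
    rw [← mul_div_assoc, div_le_iff₀ hz]
    linarith
  have h3 : |x - ξ| ≤ (|D| + ρ * (|c| + Q)) / z := by
    rw [le_div_iff₀ hz]
    have : (x - ξ) * z = D + ρ * (c - b) := by rw [hD]; ring
    calc |x - ξ| * z = |(x - ξ) * z| := by rw [abs_mul, abs_of_pos hz]
      _ = |D + ρ * (c - b)| := by rw [this]
      _ ≤ |D| + |ρ * (c - b)| := abs_add_le _ _
      _ = |D| + ρ * |c - b| := by rw [abs_mul, abs_of_pos hρ0]
      _ ≤ |D| + ρ * (|c| + Q) := by
        gcongr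
        exact (abs_sub _ _).trans (by gcongr)
  have h4 : |F - (z * ξ + ρ * c) - D| ≤ |D| / 2 + B * ρ ^ 2 := by
    have : F - (z * ξ + ρ * c) - D = (F - z * x - ρ * a) + ρ * (a - b) := by rw [hD]; ring
    rw [this]
    calc |F - z * x - ρ * a + ρ * (a - b)| ≤ |F - z * x - ρ * a| + |ρ * (a - b)| := abs_add_le _ _
      _ ≤ |K| * ρ ^ 2 + ρ * (A * ((|D| + ρ * (|c| + Q)) / z)) := by
        rw [abs_mul, abs_of_pos hρ0]
        gcongr
        · exact hF.trans (by gcongr; exact le_abs_self K)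
        · exact h1.trans (by gcongr)
      _ = (ρ * (A / z)) * |D| + B * ρ ^ 2 := by rw [hB]; ring
      _ ≤ 1 / 2 * |D| + B * ρ ^ 2 := by gcongr
      _ = _ := by ring
  have hK : (2 * B + 1) * ρ ^ 2 ≤ z * (K₁ * ρ ^ 2) := by
    have : 2 * B + 1 ≤ K₁ * z := by rwa [ge_iff_le, div_le_iff₀ hz] at hK₁
    nlinarith [sq_nonneg ρ]
  have hρ2 : 0 < ρ ^ 2 := by positivity
  have hBρ : 0 ≤ B * ρ ^ 2 := by positivity
  have e : z * (ρ / z * (c - b)) = ρ * (c - b) := by field_simp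
  constructor
  · intro hle
    have hD1 : D ≤ -(2 * B + 1) * ρ ^ 2 := by
      have := mul_le_mul_of_nonneg_left hle hz.le
      rw [hD]; linarith
    rw [abs_of_nonpos (a := D) (by linarith)] at h4
    have := (abs_le.1 h4).2
    linarith
  · intro hle
    have hD1 : (2 * B + 1) * ρ ^ 2 ≤ D := by
      have := mul_le_mul_of_nonneg_left hle hz.le
      rw [hD]; linarith
    rw [abs_of_nonneg (a := D) (by linarith)] at h4
    have := (abs_le.1 h4).1
    linarith

/-- The excess, over the slice at height `y` of the unit disc, of twice an inner length over an
outer length; the boundary curves are `O(ρ)`-perturbations of `0` and of `± p`. -/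
def sliceExcess (p K₁ K₂ K₃ : ℝ) (a b d : ℝ → ℝ) (ρ y : ℝ) : ℝ :=
  2 * (min √(1 - y ^ 2) (ρ * a y - K₁ * ρ ^ 2) + min √(1 - y ^ 2) (p + ρ * b y - K₁ * ρ ^ 2)
    - if |1 - y ^ 2 - p ^ 2| ≤ K₃ * ρ then K₂ * ρ else 0)
  - (min (√(1 - y ^ 2) + ρ ^ 2) (p - ρ * d y + K₁ * ρ ^ 2)
    + min (√(1 - y ^ 2) + ρ ^ 2) (p + ρ * b y + K₁ * ρ ^ 2))

lemma measurable_sliceExcess {p K₁ K₂ K₃ : ℝ} {a b d : ℝ → ℝ} (ha : Measurable a)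
    (hb : Measurable b) (hd : Measurable d) (ρ : ℝ) :
    Measurable (sliceExcess p K₁ K₂ K₃ a b d ρ) := by
  unfold sliceExcess
  have : MeasurableSet {y : ℝ | |1 - y ^ 2 - p ^ 2| ≤ K₃ * ρ} :=
    measurableSet_le (by fun_prop) (by fun_prop)
  have h2 : Measurable fun y : ℝ => if |1 - y ^ 2 - p ^ 2| ≤ K₃ * ρ then K₂ * ρ else 0 :=
    Measurable.ite this measurable_const measurable_const
  fun_prop

lemma abs_sliceExcess_le {p K₁ K₂ K₃ C ρ y : ℝ} {a b d : ℝ → ℝ} (hρ : 0 < ρ) (hρ1 : ρ ≤ 1)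
    (hK₁ : 0 ≤ K₁) (hK₂ : 0 ≤ K₂) (ha : |a y| ≤ C) (hb : |b y| ≤ C) (hd : |d y| ≤ C) :
    |sliceExcess p K₁ K₂ K₃ a b d ρ y| ≤ (6 * (C + K₁ + 1) + 2 * K₂) * ρ := by
  unfold sliceExcess
  set s := √(1 - y ^ 2)
  have hs : 0 ≤ s := Real.sqrt_nonneg _
  have hρ2 : ρ ^ 2 ≤ ρ := by nlinarith
  have hC : 0 ≤ C := (abs_nonneg _).trans ha
  have hK : K₁ * ρ ^ 2 ≤ K₁ * ρ := by gcongr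
  have hK0 : 0 ≤ K₁ * ρ ^ 2 := by positivity
  have hK₂ρ : 0 ≤ K₂ * ρ := by positivity
  have hCρ : 0 ≤ C * ρ := by positivity
  have hKρ : 0 ≤ K₁ * ρ := by positivity
  have key : ∀ t : ℝ, |t| ≤ C → |ρ * t| ≤ C * ρ := fun t ht => by
    rw [abs_mul, abs_of_pos hρ, mul_comm]; gcongr
  have ka := abs_le.1 (key _ ha)
  have kb := abs_le.1 (key _ hb)
  have kd := abs_le.1 (key _ hd)
  have e0 : |min s (ρ * a y - K₁ * ρ ^ 2)| ≤ (C + K₁ + 1) * ρ := by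
    rw [abs_le]
    constructor
    · exact le_min (by nlinarith) (by nlinarith)
    · exact (min_le_right _ _).trans (by nlinarith)
  have e1 : |min s (p + ρ * b y - K₁ * ρ ^ 2) - min s p| ≤ (C + K₁ + 1) * ρ := by
    refine (abs_min_sub_min_le_max _ _ _ _).trans (max_le ?_ ?_) <;> rw [abs_le] <;>
      constructor <;> nlinarith
  have e2 : |min (s + ρ ^ 2) (p - ρ * d y + K₁ * ρ ^ 2) - min s p| ≤ (C + K₁ + 1) * ρ := by
    refine (abs_min_sub_min_le_max _ _ _ _).trans (max_le ?_ ?_) <;> rw [abs_le] <;>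
      constructor <;> nlinarith
  have e3 : |min (s + ρ ^ 2) (p + ρ * b y + K₁ * ρ ^ 2) - min s p| ≤ (C + K₁ + 1) * ρ := by
    refine (abs_min_sub_min_le_max _ _ _ _).trans (max_le ?_ ?_) <;> rw [abs_le] <;>
      constructor <;> nlinarith
  have e4 : |(if |1 - y ^ 2 - p ^ 2| ≤ K₃ * ρ then K₂ * ρ else 0)| ≤ K₂ * ρ := by
    split_ifs
    · rw [abs_of_nonneg hK₂ρ]
    · simpa using hK₂ρ
  rw [abs_le] at *
  constructor <;> linarith

lemma tendsto_sliceExcess_div {p : ℝ} (hp : 0 < p) (K₁ K₂ K₃ : ℝ) (a b d : ℝ → ℝ) {y : ℝ}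
    (hy : y ^ 2 < 1) (hyp : y ^ 2 ≠ 1 - p ^ 2) :
    Tendsto (fun ρ => sliceExcess p K₁ K₂ K₃ a b d ρ y / ρ) (𝓝[>] 0)
      (𝓝 (2 * a y + if y ^ 2 < 1 - p ^ 2 then b y + d y else 0)) := by
  unfold sliceExcess
  set s := √(1 - y ^ 2) with hs
  have hs0 : 0 < s := Real.sqrt_pos.2 (by linarith)
  have hs2 : s ^ 2 = 1 - y ^ 2 := Real.sq_sqrt (by linarith)
  have hpos : ∀ᶠ ρ in 𝓝[>] (0 : ℝ), 0 < ρ := self_mem_nhdsWithin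
  have hlt : ∀ g h : ℝ → ℝ, Continuous g → Continuous h → g 0 < h 0 →
      ∀ᶠ ρ in 𝓝[>] (0 : ℝ), g ρ < h ρ := fun g h hg hh h0 =>
    eventually_nhdsWithin_of_eventually_nhds
      (hg.continuousAt.eventually_lt hh.continuousAt h0)
  have hY : ∀ᶠ ρ in 𝓝[>] (0 : ℝ), K₃ * ρ < |1 - y ^ 2 - p ^ 2| :=
    hlt _ _ (by fun_prop) (by fun_prop) (by
      simp only [mul_zero]
      exact abs_pos.2 fun h => hyp (by linarith))
  have h0 : ∀ᶠ ρ in 𝓝[>] (0 : ℝ), ρ * a y - K₁ * ρ ^ 2 < s :=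
    hlt _ _ (by fun_prop) (by fun_prop) (by simpa using hs0)
  have hlim : ∀ g : ℝ → ℝ, Continuous g → Tendsto g (𝓝[>] 0) (𝓝 (g 0)) := fun g hg =>
    hg.continuousAt.tendsto.mono_left nhdsWithin_le_nhds
  rcases lt_or_gt_of_ne hyp with h | h
  · have hps : p < s := by nlinarith
    have h1 : ∀ᶠ ρ in 𝓝[>] (0 : ℝ), p + ρ * b y - K₁ * ρ ^ 2 < s :=
      hlt _ _ (by fun_prop) (by fun_prop) (by simpa using hps)
    have h2 : ∀ᶠ ρ in 𝓝[>] (0 : ℝ), p - ρ * d y + K₁ * ρ ^ 2 < s + ρ ^ 2 :=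
      hlt _ _ (by fun_prop) (by fun_prop) (by simpa using hps)
    have h3 : ∀ᶠ ρ in 𝓝[>] (0 : ℝ), p + ρ * b y + K₁ * ρ ^ 2 < s + ρ ^ 2 :=
      hlt _ _ (by fun_prop) (by fun_prop) (by simpa using hps)
    rw [if_pos h]
    have := hlim (fun ρ => 2 * a y + (b y + d y) - 6 * K₁ * ρ) (by fun_prop)
    simp only [mul_zero, sub_zero] at this
    refine this.congr' ?_
    filter_upwards [hpos, hY, h0, h1, h2, h3] with ρ hρ gY g0 g1 g2 g3
    rw [if_neg gY.not_ge, min_eq_right g0.le, min_eq_right g1.le, min_eq_right g2.le,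
      min_eq_right g3.le]
    field_simp
    ring
  · have hps : s < p := by nlinarith
    have h1 : ∀ᶠ ρ in 𝓝[>] (0 : ℝ), s < p + ρ * b y - K₁ * ρ ^ 2 :=
      hlt _ _ (by fun_prop) (by fun_prop) (by simpa using hps)
    have h2 : ∀ᶠ ρ in 𝓝[>] (0 : ℝ), s + ρ ^ 2 < p - ρ * d y + K₁ * ρ ^ 2 :=
      hlt _ _ (by fun_prop) (by fun_prop) (by simpa using hps)
    have h3 : ∀ᶠ ρ in 𝓝[>] (0 : ℝ), s + ρ ^ 2 < p + ρ * b y + K₁ * ρ ^ 2 :=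
      hlt _ _ (by fun_prop) (by fun_prop) (by simpa using hps)
    rw [if_neg h.not_gt]
    have := hlim (fun ρ => 2 * a y + 0 - (2 * K₁ + 2) * ρ) (by fun_prop)
    simp only [mul_zero, sub_zero] at this
    refine this.congr' ?_
    filter_upwards [hpos, hY, h0, h1, h2, h3] with ρ hρ gY g0 g1 g2 g3
    rw [if_neg gY.not_ge, min_eq_right g0.le, min_eq_left g1.le, min_eq_left g2.le,
      min_eq_left g3.le]
    field_simp
    ring

lemma tendsto_integral_sliceExcess_div {p : ℝ} (hp : 0 < p) {K₁ K₂ : ℝ} (hK₁ : 0 ≤ K₁)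
    (hK₂ : 0 ≤ K₂) (K₃ : ℝ) {a b d : ℝ → ℝ} (ha : Continuous a) (hb : Continuous b)
    (hd : Continuous d) :
    Tendsto (fun ρ => ∫ y in Set.Icc (-1) 1, sliceExcess p K₁ K₂ K₃ a b d ρ y / ρ) (𝓝[>] 0)
      (𝓝 (∫ y in Set.Icc (-1) 1, (2 * a y + if y ^ 2 < 1 - p ^ 2 then b y + d y else 0))) := by
  have hbd : ∀ g : ℝ → ℝ, Continuous g → ∃ C, ∀ y ∈ Set.Icc (-1 : ℝ) 1, |g y| ≤ C :=
    fun g hg => isCompact_Icc.exists_bound_of_continuousOn hg.continuousOn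
  obtain ⟨Ca, hCa⟩ := hbd a ha
  obtain ⟨Cb, hCb⟩ := hbd b hb
  obtain ⟨Cd, hCd⟩ := hbd d hd
  set C := max Ca (max Cb Cd)
  refine tendsto_integral_filter_of_dominated_convergence
    (fun _ => 6 * (C + K₁ + 1) + 2 * K₂) ?_ ?_ ?_ ?_
  · exact Eventually.of_forall fun ρ =>
      ((measurable_sliceExcess ha.measurable hb.measurable hd.measurable ρ).div_const
        ρ).aestronglyMeasurable
  · have h1 : ∀ᶠ ρ in 𝓝[>] (0 : ℝ), ρ < 1 :=
      eventually_nhdsWithin_of_eventually_nhds (eventually_lt_nhds one_pos)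
    filter_upwards [self_mem_nhdsWithin, h1] with ρ hρ hρ1
    refine (ae_restrict_iff' measurableSet_Icc).2 (Eventually.of_forall fun y hy => ?_)
    have hρ : 0 < ρ := hρ
    rw [Real.norm_eq_abs, abs_div, abs_of_pos hρ, div_le_iff₀ hρ]
    exact abs_sliceExcess_le hρ hρ1.le hK₁ hK₂ ((hCa y hy).trans (le_max_left _ _))
      ((hCb y hy).trans ((le_max_left _ _).trans (le_max_right _ _)))
      ((hCd y hy).trans ((le_max_right _ _).trans (le_max_right _ _)))
  · exact integrable_const _
  · have hfin : ({1, -1, √(1 - p ^ 2), -√(1 - p ^ 2)} : Set ℝ).Finite := by simp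
    have hae : ∀ᵐ y : ℝ, y ∉ ({1, -1, √(1 - p ^ 2), -√(1 - p ^ 2)} : Set ℝ) :=
      hfin.countable.ae_notMem _
    filter_upwards [ae_restrict_of_ae hae, ae_restrict_mem measurableSet_Icc] with y hy hy1
    simp only [Set.mem_insert_iff, Set.mem_singleton_iff, not_or] at hy
    obtain ⟨n1, n2, n3, n4⟩ := hy
    refine tendsto_sliceExcess_div hp _ _ _ _ _ _ ?_ ?_
    · have l1 : -1 < y := lt_of_le_of_ne hy1.1 (Ne.symm n2)
      have l2 : y < 1 := lt_of_le_of_ne hy1.2 n1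
      nlinarith
    · intro h
      rw [← h, Real.sqrt_sq_eq_abs] at n3 n4
      rcases abs_choice y with e | e <;> rw [e] at n3 n4
      · exact n3 rfl
      · exact n4 (by ring)

/-- The limit value of the normalised excess. -/
lemma integral_limit_sliceExcess (z p N T c : ℝ) :
    ∫ y in Set.Icc (-1 : ℝ) 1, (2 * ((c - T * y ^ 2 / 2) / z)
      + if y ^ 2 < 1 - p ^ 2 then (N * p ^ 2 + T * y ^ 2) / z else 0)
      = 4 / z * (c - ((1 - √(1 - p ^ 2) ^ 3) * T - 3 * √(1 - p ^ 2) * p ^ 2 * N) / 6) := by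
  set k := √(1 - p ^ 2) with hk
  have hk0 : 0 ≤ k := Real.sqrt_nonneg _
  have hk1 : k ≤ 1 := Real.sqrt_le_one.2 (by nlinarith)
  have hset : ∀ y : ℝ, (if y ^ 2 < 1 - p ^ 2 then (N * p ^ 2 + T * y ^ 2) / z else 0)
      = (Set.Ioo (-k) k).indicator (fun y => (N * p ^ 2 + T * y ^ 2) / z) y := by
    intro y
    rw [Set.indicator_apply]
    congr 1
    rw [Real.sq_lt, Set.mem_Ioo]
  simp_rw [hset]
  have hc : Continuous fun y : ℝ => (N * p ^ 2 + T * y ^ 2) / z := by fun_prop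
  have hc2 : Continuous fun y : ℝ => 2 * ((c - T * y ^ 2 / 2) / z) := by fun_prop
  rw [integral_add (hc2.continuousOn.integrableOn_Icc)
    ((hc.continuousOn.integrableOn_Icc).indicator measurableSet_Ioo),
    setIntegral_indicator measurableSet_Ioo,
    Set.inter_eq_right.2 (show Set.Ioo (-k) k ⊆ Set.Icc (-1) 1 from fun y hy =>
      ⟨by linarith [hy.1], by linarith [hy.2]⟩),
    integral_Icc_eq_integral_Ioc, ← integral_Ioc_eq_integral_Ioo,
    ← intervalIntegral.integral_of_le (by norm_num), ← intervalIntegral.integral_of_le (by linarith)]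
  have e1 : ∀ y : ℝ, 2 * ((c - T * y ^ 2 / 2) / z) = 2 * c / z - T / z * y ^ 2 := fun y => by ring
  have e2 : ∀ y : ℝ, (N * p ^ 2 + T * y ^ 2) / z = N * p ^ 2 / z + T / z * y ^ 2 :=
    fun y => by ring
  simp_rw [e1, e2]
  rw [intervalIntegral.integral_sub (by simp) (Continuous.intervalIntegrable (by fun_prop) _ _),
    intervalIntegral.integral_add (by simp) (Continuous.intervalIntegrable (by fun_prop) _ _),
    intervalIntegral.integral_const_mul, intervalIntegral.integral_const_mul, integral_pow,
    integral_pow]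
  simp only [intervalIntegral.integral_const, smul_eq_mul]
  ring

lemma half_volume_lt_of_regionBetween {S S' : Set (ℝ × ℝ)} {l u l' u' : ℝ → ℝ} {I : Set ℝ}
    (hI : MeasurableSet I) (hl : IntegrableOn l I) (hu : IntegrableOn u I)
    (hl' : IntegrableOn l' I) (hu' : IntegrableOn u' I)
    (h : S ⊆ regionBetween l u I) (h' : regionBetween l' u' I ⊆ S')
    (hlu : ∀ y ∈ I, l y ≤ u y)
    (hpos : 0 < ∫ y in I, (2 * (u' y - l' y) - (u y - l y))) :
    volume S / 2 < volume S' := by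
  have i1 : IntegrableOn (fun y => 2 * (u' y - l' y)) I := (hu'.sub hl').const_mul 2
  have i2 : IntegrableOn (fun y => u y - l y) I := hu.sub hl
  rw [integral_sub i1 i2, integral_const_mul] at hpos
  have hJ : 0 ≤ ∫ y in I, (u y - l y) :=
    setIntegral_nonneg hI fun y hy => sub_nonneg.2 (hlu y hy)
  have hS : volume S ≤ ENNReal.ofReal (∫ y in I, (u y - l y)) := by
    refine (measure_mono h).trans_eq ?_
    rw [Measure.volume_eq_prod, volume_regionBetween_eq_integral hl hu hI hlu]
    rfl
  have hS' : ENNReal.ofReal (∫ y in I, (u' y - l' y)) ≤ volume S' := by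
    refine le_trans ?_ (measure_mono h')
    have hmax : IntegrableOn (fun y => max (l' y) (u' y)) I := hl'.sup hu'
    have hreg : regionBetween l' u' I = regionBetween l' (fun y => max (l' y) (u' y)) I := by
      ext ⟨y, x⟩
      simp only [regionBetween, Set.mem_ofPred_eq, Set.mem_Ioo, lt_max_iff]
      constructor
      · rintro ⟨h1, h2, h3⟩
        exact ⟨h1, h2, Or.inr h3⟩
      · rintro ⟨h1, h2, h3 | h3⟩
        · exact absurd h2 h3.not_gt
        · exact ⟨h1, h2, h3⟩
    rw [hreg, Measure.volume_eq_prod,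
      volume_regionBetween_eq_integral hl' hmax hI fun y _ => le_max_left _ _]
    refine ENNReal.ofReal_le_ofReal (integral_mono (hu'.sub hl') (hmax.sub hl') fun y => ?_)
    simp
  calc volume S / 2 ≤ ENNReal.ofReal (∫ y in I, (u y - l y)) / 2 := by gcongr
    _ = ENNReal.ofReal ((∫ y in I, (u y - l y)) / 2) := by
      rw [ENNReal.ofReal_div_of_pos two_pos, ENNReal.ofReal_ofNat]
    _ < ENNReal.ofReal (∫ y in I, (u' y - l' y)) :=
      (ENNReal.ofReal_lt_ofReal_iff_of_nonneg (by linarith)).2 (by linarith)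
    _ ≤ volume S' := hS'

/-- A point of the unit disc lying in the transition zone, to the left of a small abscissa, has
height close to that of the corner of the truncated disc. -/
lemma transition_zone {p K C ρ x y : ℝ} (hp : 0 < p) (hK : 0 ≤ K) (hρ : 0 < ρ)
    (hxy : x ^ 2 + y ^ 2 ≤ 1) (hr : 1 - K * ρ < √(x ^ 2 + y ^ 2))
    (hxp : |(|x| - p * √(x ^ 2 + y ^ 2))| < K * ρ) (hx : x < C * ρ)
    (hsmall : C * ρ < p - (1 + p) * K * ρ) :
    x < -p + (1 + p) * K * ρ ∧ |1 - y ^ 2 - p ^ 2| ≤ (2 * K + (1 + p) ^ 2 * K) * ρ := by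
  set r := √(x ^ 2 + y ^ 2) with hr'
  have hr0 : 0 ≤ r := Real.sqrt_nonneg _
  have hr1 : r ≤ 1 := Real.sqrt_le_one.2 hxy
  have hr2 : r ^ 2 = x ^ 2 + y ^ 2 := Real.sq_sqrt (by positivity)
  have hKρ : 0 ≤ K * ρ := by positivity
  have hpr : p * (1 - r) ≤ p * (K * ρ) := by gcongr; linarith
  have hpr0 : 0 ≤ p * (1 - r) := mul_nonneg hp.le (by linarith)
  have hx1 : |x| ≤ 1 := (sq_le_one_iff_abs_le_one x).1 (by nlinarith [sq_nonneg y])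
  have hd : |(|x| - p)| ≤ (1 + p) * K * ρ := by
    rw [abs_lt] at hxp
    rw [abs_le]
    constructor <;> nlinarith
  have hlow : p - (1 + p) * K * ρ < |x| := by
    rw [abs_lt] at hxp
    nlinarith
  constructor
  · rcases abs_choice x with e | e <;> rw [e] at hlow <;> linarith
  · have e : 1 - y ^ 2 - p ^ 2 = (1 - r) * (1 + r) + (|x| - p) * (|x| + p) := by
      have := sq_abs x
      linear_combination hr2 - this
    rw [e]
    refine (abs_add_le _ _).trans ?_
    rw [abs_mul, abs_mul, abs_of_nonneg (show 0 ≤ 1 - r by linarith),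
      abs_of_nonneg (show 0 ≤ 1 + r by linarith),
      abs_of_nonneg (show 0 ≤ |x| + p by positivity)]
    have h1 : (1 - r) * (1 + r) ≤ (K * ρ) * 2 := by gcongr <;> linarith
    have h2 : |(|x| - p)| * (|x| + p) ≤ ((1 + p) * K * ρ) * (1 + p) := by gcongr
    linarith

/-- The rescaled median inequality: if `S ρ` is the unit disc truncated by `|F| ≤ z p`, up to a
transition zone, where `F = z x + ρ q(x, y) + O(ρ²)`, then the part of `S ρ` on which `F < ρ c`
exceeds half of `S ρ` as soon as `c` is larger than the critical value. -/
lemma eventually_half_volume_lt {z p K : ℝ} (hz : 0 < z) (hp : 0 < p) (hK : 0 ≤ K)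
    {N M T c : ℝ} {F : ℝ → ℝ → ℝ → ℝ} {S : ℝ → Set (ℝ × ℝ)}
    (hF : ∀ᶠ ρ in 𝓝[>] (0 : ℝ), ∀ x y : ℝ, x ^ 2 + y ^ 2 ≤ 1 →
      |F ρ y x - z * x - ρ * halfQuad N M T x y| ≤ K * ρ ^ 2)
    (hS : ∀ᶠ ρ in 𝓝[>] (0 : ℝ), ∀ x y : ℝ, (y, x) ∈ S ρ →
      x ^ 2 + y ^ 2 ≤ 1 ∧ |F ρ y x| ≤ z * p)
    (hS' : ∀ᶠ ρ in 𝓝[>] (0 : ℝ), ∀ x y : ℝ, x ^ 2 + y ^ 2 ≤ 1 → |F ρ y x| ≤ z * p →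
      (√(x ^ 2 + y ^ 2) ≤ 1 - K * ρ ∨ K * ρ ≤ |(|x| - p * √(x ^ 2 + y ^ 2))|) → (y, x) ∈ S ρ)
    (hc : ((1 - √(1 - p ^ 2) ^ 3) * T - 3 * √(1 - p ^ 2) * p ^ 2 * N) / 6 < c) :
    ∀ᶠ ρ in 𝓝[>] (0 : ℝ), volume (S ρ) / 2 < volume {w ∈ S ρ | F ρ w.1 w.2 < ρ * c} := by
  obtain ⟨k0, hk0, h0⟩ := exists_level_bounds hz N M T 0 c K
  obtain ⟨k1, hk1, h1⟩ := exists_level_bounds hz N M T p 0 K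
  obtain ⟨k2, hk2, h2⟩ := exists_level_bounds hz N M T (-p) 0 K
  set K₁ := max k0 (max k1 k2) with hK₁
  have hK₁0 : 0 < K₁ := lt_max_of_lt_left hk0
  set a : ℝ → ℝ := fun y => (c - halfQuad N M T 0 y) / z with ha
  set b : ℝ → ℝ := fun y => halfQuad N M T (-p) y / z with hb
  set d : ℝ → ℝ := fun y => halfQuad N M T p y / z with hd
  have hac : Continuous a := by simp only [ha, halfQuad]; fun_prop
  have hbc : Continuous b := by simp only [hb, halfQuad]; fun_prop
  have hdc : Continuous d := by simp only [hd, halfQuad]; fun_prop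
  obtain ⟨Ca, hCa⟩ := isCompact_Icc.exists_bound_of_continuousOn
    (hac.continuousOn (s := Set.Icc (-1 : ℝ) 1))
  obtain ⟨Cb, hCb⟩ := isCompact_Icc.exists_bound_of_continuousOn
    (hbc.continuousOn (s := Set.Icc (-1 : ℝ) 1))
  obtain ⟨Cd, hCd⟩ := isCompact_Icc.exists_bound_of_continuousOn
    (hdc.continuousOn (s := Set.Icc (-1 : ℝ) 1))
  set C := max Ca (max Cb Cd)
  have hC0 : 0 ≤ C := ((norm_nonneg _).trans (hCa 0 (by norm_num))).trans (le_max_left _ _)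
  set K₂ := C + (1 + p) * K with hK₂
  set K₃ := 2 * K + (1 + p) ^ 2 * K with hK₃
  have hK₂0 : 0 ≤ K₂ := by positivity
  have hlim := tendsto_integral_sliceExcess_div hp hK₁0.le hK₂0 K₃ hac hbc hdc
  have hval : ∫ y in Set.Icc (-1 : ℝ) 1,
      (2 * a y + if y ^ 2 < 1 - p ^ 2 then b y + d y else 0)
      = 4 / z * (c - ((1 - √(1 - p ^ 2) ^ 3) * T - 3 * √(1 - p ^ 2) * p ^ 2 * N) / 6) := by
    rw [← integral_limit_sliceExcess z p N T c]
    congr 1 with y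
    have e1 : a y = (c - T * y ^ 2 / 2) / z := by simp only [ha, halfQuad]; ring
    have e2 : b y + d y = (N * p ^ 2 + T * y ^ 2) / z := by simp only [hb, hd, halfQuad]; ring
    rw [e1, e2]
  rw [hval] at hlim
  have hpos := hlim.eventually_const_lt (show (0 : ℝ) < _ from
    mul_pos (by positivity) (sub_pos.2 hc))
  have hlt : ∀ g h : ℝ → ℝ, Continuous g → Continuous h → g 0 < h 0 →
      ∀ᶠ ρ in 𝓝[>] (0 : ℝ), g ρ < h ρ := fun g h hg hh h0 =>
    eventually_nhdsWithin_of_eventually_nhds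
      (hg.continuousAt.eventually_lt hh.continuousAt h0)
  have hsm1 : ∀ᶠ ρ in 𝓝[>] (0 : ℝ), C * ρ < p - (1 + p) * K * ρ :=
    hlt _ _ (by fun_prop) (by fun_prop) (by simpa using hp)
  have hsm2 : ∀ᶠ ρ in 𝓝[>] (0 : ℝ), ρ * c < z * p :=
    hlt _ _ (by fun_prop) (by fun_prop) (by simpa using mul_pos hz hp)
  filter_upwards [h0, h1, h2, hF, hS, hS', hpos, hsm1, hsm2, self_mem_nhdsWithin]
    with ρ h0 h1 h2 hF hS hS' hpos hsm1 hsm2 hρ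
  have hρ : 0 < ρ := hρ
  have h0 := h0 K₁ (le_max_left _ _)
  have h1 := h1 K₁ ((le_max_left _ _).trans (le_max_right _ _))
  have h2 := h2 K₁ ((le_max_right _ _).trans (le_max_right _ _))
  have hρC : ∀ t, |t| ≤ C → |ρ * t| ≤ C * ρ := fun t ht => by
    rw [abs_mul, abs_of_pos hρ, mul_comm]; gcongr
  have hKρ2 : 0 < K₁ * ρ ^ 2 := by positivity
  have hKρ : 0 ≤ (1 + p) * K * ρ := by positivity
  have hm : MeasurableSet {y : ℝ | |1 - y ^ 2 - p ^ 2| ≤ K₃ * ρ} :=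
    measurableSet_le (by fun_prop) (by fun_prop)
  have hind : IntegrableOn (fun y : ℝ => if |1 - y ^ 2 - p ^ 2| ≤ K₃ * ρ then K₂ * ρ else 0)
      (Set.Icc (-1) 1) :=
    (integrable_const (K₂ * ρ)).indicator hm
  refine half_volume_lt_of_regionBetween (I := Set.Icc (-1) 1)
    (l := fun y => -min (√(1 - y ^ 2) + ρ ^ 2) (p + ρ * b y + K₁ * ρ ^ 2))
    (u := fun y => min (√(1 - y ^ 2) + ρ ^ 2) (p - ρ * d y + K₁ * ρ ^ 2))
    (l' := fun y => -min √(1 - y ^ 2) (p + ρ * b y - K₁ * ρ ^ 2) +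
      if |1 - y ^ 2 - p ^ 2| ≤ K₃ * ρ then K₂ * ρ else 0)
    (u' := fun y => min √(1 - y ^ 2) (ρ * a y - K₁ * ρ ^ 2)) measurableSet_Icc
    (Continuous.continuousOn (by fun_prop)).integrableOn_Icc
    (Continuous.continuousOn (by fun_prop)).integrableOn_Icc
    ((Continuous.continuousOn (by fun_prop)).integrableOn_Icc.add hind)
    (Continuous.continuousOn (by fun_prop)).integrableOn_Icc ?_ ?_ ?_ ?_
  · rintro ⟨y, x⟩ hyx
    obtain ⟨hxy, hFx⟩ := hS x y hyx
    have hy : |y| ≤ 1 := (sq_le_one_iff_abs_le_one y).1 (by nlinarith [sq_nonneg x])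
    have hs : |x| ≤ √(1 - y ^ 2) := Real.abs_le_sqrt (by linarith)
    have hρ2 : 0 < ρ ^ 2 := by positivity
    rw [abs_le] at hFx hs
    have g1 := (h1 x y _ hxy (hF x y hxy)).2
    have g2 := (h2 x y _ hxy (hF x y hxy)).1
    refine ⟨abs_le.1 hy, ?_, ?_⟩
    · show -min _ _ < x
      rw [neg_lt, lt_min_iff]
      refine ⟨by linarith, ?_⟩
      by_contra! hcon
      have := g2 (by
        have e : ρ / z * (0 - halfQuad N M T (-p) y) = -(ρ * b y) := by simp only [hb]; ring
        rw [e]; linarith)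
      linarith
    · show x < min _ _
      rw [lt_min_iff]
      refine ⟨by linarith, ?_⟩
      by_contra! hcon
      have := g1 (by
        have e : ρ / z * (0 - halfQuad N M T p y) = -(ρ * d y) := by simp only [hd]; ring
        rw [e]; linarith)
      linarith
  · rintro ⟨y, x⟩ ⟨hy, hlx, hxu⟩
    replace hlx : -min √(1 - y ^ 2) (p + ρ * b y - K₁ * ρ ^ 2) +
      (if |1 - y ^ 2 - p ^ 2| ≤ K₃ * ρ then K₂ * ρ else 0) < x := hlx
    replace hxu : x < min √(1 - y ^ 2) (ρ * a y - K₁ * ρ ^ 2) := hxu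
    replace hy : y ∈ Set.Icc (-1 : ℝ) 1 := hy
    have hind0 : 0 ≤ if |1 - y ^ 2 - p ^ 2| ≤ K₃ * ρ then K₂ * ρ else 0 := by
      split_ifs <;> positivity
    have hm1 := min_le_left √(1 - y ^ 2) (p + ρ * b y - K₁ * ρ ^ 2)
    have hm2 := min_le_right √(1 - y ^ 2) (p + ρ * b y - K₁ * ρ ^ 2)
    rw [lt_min_iff] at hxu
    have hy2 : y ^ 2 ≤ 1 := (sq_le_one_iff_abs_le_one y).2 (abs_le.2 hy)
    have hxy : x ^ 2 + y ^ 2 ≤ 1 := by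
      have : |x| ≤ √(1 - y ^ 2) := abs_le.2 ⟨by linarith, hxu.1.le⟩
      have := sq_le_sq' (by linarith [abs_nonneg x]) this
      rw [sq_abs, Real.sq_sqrt (by linarith)] at this
      linarith
    have hab := abs_le.1 (hρC _ ((hCa y hy).trans (le_max_left _ _)))
    have hbb := abs_le.1 (hρC _ ((hCb y hy).trans ((le_max_left _ _).trans (le_max_right _ _))))
    have hFc : F ρ y x < ρ * c := by
      have := (h0 x y _ hxy (hF x y hxy)).1 (by
        have e : ρ / z * (c - halfQuad N M T 0 y) = ρ * a y := by simp only [ha]; ring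
        rw [e]; linarith [hxu.2])
      linarith
    have hFl : -(z * p) < F ρ y x := by
      have := (h2 x y _ hxy (hF x y hxy)).2 (by
        have e : ρ / z * (0 - halfQuad N M T (-p) y) = -(ρ * b y) := by simp only [hb]; ring
        rw [e]; linarith)
      linarith
    refine ⟨hS' x y hxy (abs_le.2 ⟨hFl.le, by linarith⟩) ?_, hFc⟩
    by_contra! hbad
    obtain ⟨t1, t2⟩ := transition_zone hp hK hρ hxy hbad.1 hbad.2
      (show x < C * ρ by linarith [hxu.2]) hsm1
    rw [if_pos t2, hK₂] at hlx
    linarith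
  · intro y hy
    have hbb := abs_le.1 (hρC _ ((hCb y hy).trans ((le_max_left _ _).trans (le_max_right _ _))))
    have hdd := abs_le.1 (hρC _ ((hCd y hy).trans ((le_max_right _ _).trans (le_max_right _ _))))
    have hs : 0 ≤ √(1 - y ^ 2) + ρ ^ 2 := by positivity
    have g1 : 0 ≤ min (√(1 - y ^ 2) + ρ ^ 2) (p + ρ * b y + K₁ * ρ ^ 2) :=
      le_min hs (by linarith)
    have g2 : 0 ≤ min (√(1 - y ^ 2) + ρ ^ 2) (p - ρ * d y + K₁ * ρ ^ 2) :=
      le_min hs (by linarith)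
    show -min _ _ ≤ min _ _
    linarith
  · have e : ∀ y, sliceExcess p K₁ K₂ K₃ a b d ρ y / ρ = ρ⁻¹ * sliceExcess p K₁ K₂ K₃ a b d ρ y :=
      fun y => by rw [div_eq_inv_mul]
    simp_rw [e] at hpos
    rw [integral_const_mul] at hpos
    have := (mul_pos_iff_of_pos_left (inv_pos.2 hρ)).1 hpos
    refine this.trans_eq ?_
    congr 1 with y
    unfold sliceExcess
    ring

lemma intervalIntegrable_deriv_of_contDiffOn_Icc {E : Type*} [NormedAddCommGroup E]
    [NormedSpace ℝ E] {φ : ℝ → E} {a b : ℝ} (hab : a < b)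
    (hφ : ContDiffOn ℝ 1 φ (Set.Icc a b)) : IntervalIntegrable (deriv φ) volume a b := by
  have h1 : ContinuousOn (derivWithin φ (Set.Icc a b)) (Set.Icc a b) :=
    hφ.continuousOn_derivWithin (uniqueDiffOn_Icc hab) le_rfl
  have h2 : IntegrableOn (derivWithin φ (Set.Icc a b)) (Set.Ioo a b) :=
    h1.integrableOn_Icc.mono_set Set.Ioo_subset_Icc_self
  rw [intervalIntegrable_iff_integrableOn_Ioo_of_le hab.le]
  refine h2.congr_fun (fun t ht => ?_) measurableSet_Ioo
  exact derivWithin_of_mem_nhds (Icc_mem_nhds ht.1 ht.2)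

lemma PiecewiseC1.norm_sub_le {E : Type*} [NormedAddCommGroup E] [NormedSpace ℝ E]
    [CompleteSpace E] {c : ℝ → Plane} (hc : PiecewiseC1 c) {φ : Plane → E}
    (hφ : ContDiff ℝ 1 φ) {f : Plane → ℝ} (hf : ContDiff ℝ 1 f) {β : ℝ}
    (h : ∀ t, ‖deriv (φ ∘ c) t‖ ≤ max ‖deriv c t‖ (β * |deriv (f ∘ c) t|)) :
    ‖φ (c 1) - φ (c 0)‖ ≤ ∫ t in (0 : ℝ)..1, max ‖deriv c t‖ (β * |deriv (f ∘ c) t|) := by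
  obtain ⟨-, n, t, ht0, htn, hlt, hcd⟩ := hc
  have h_int : ∀ i < n, IntervalIntegrable
      (fun t => max ‖deriv c t‖ (β * |deriv (f ∘ c) t|)) volume (t i) (t (i + 1)) := by
    intro i hi
    have h1 := (intervalIntegrable_deriv_of_contDiffOn_Icc (hlt i hi) (hcd i hi)).norm
    have h2 := (intervalIntegrable_deriv_of_contDiffOn_Icc (hlt i hi)
      (hf.comp_contDiffOn (hcd i hi))).norm.const_mul β
    rw [intervalIntegrable_iff_integrableOn_Ioc_of_le (hlt i hi).le] at h1 h2 ⊢
    exact h1.sup h2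
  have hpiece : ∀ i < n, ‖φ (c (t (i + 1))) - φ (c (t i))‖ ≤
      ∫ s in t i..t (i + 1), max ‖deriv c s‖ (β * |deriv (f ∘ c) s|) := by
    intro i hi
    have h1 := intervalIntegral.integral_deriv_of_contDiffOn_Icc
      (hφ.comp_contDiffOn (hcd i hi)) (hlt i hi).le
    have h2 := intervalIntegral.norm_integral_le_of_norm_le (hlt i hi).le
      (Eventually.of_forall fun s _ => h s) (h_int i hi)
    rw [h1] at h2
    exact h2
  rw [← ht0, ← htn, ← intervalIntegral.sum_integral_adjacent_intervals h_int,
    ← Finset.sum_range_sub fun i => φ (c (t i))]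
  exact (norm_sum_le _ _).trans
    (Finset.sum_le_sum fun i hi => hpiece i (Finset.mem_range.1 hi))

lemma piecewiseC1_segment (x v : Plane) : PiecewiseC1 fun t => x + t • v := by
  refine ⟨by fun_prop, 1, fun i => i, by simp, by simp, by simp, fun i _ => ?_⟩
  exact ContDiff.contDiffOn (by fun_prop)

lemma le_amoebaDistLinf {f : Plane → ℝ} {β A : ℝ} {p q : Plane}
    (h : ∀ c : ℝ → Plane, PiecewiseC1 c → c 0 = p → c 1 = q →
      A ≤ ∫ t in (0 : ℝ)..1, max ‖deriv c t‖ (β * |deriv (f ∘ c) t|)) :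
    A ≤ amoebaDistLinf β f p q := by
  refine le_csInf ⟨_, _, piecewiseC1_segment p (q - p), by simp, by simp, rfl⟩ ?_
  rintro L ⟨c, hc, h0, h1, rfl⟩
  exact h c hc h0 h1

lemma norm_sub_le_amoebaDistLinf {f : Plane → ℝ} (hf : ContDiff ℝ 1 f) (β : ℝ) (p q : Plane) :
    ‖q - p‖ ≤ amoebaDistLinf β f p q := by
  refine le_amoebaDistLinf fun c hc h0 h1 => ?_
  rw [← h0, ← h1]
  exact hc.norm_sub_le contDiff_id hf fun t => le_max_left _ _

lemma abs_sub_le_amoebaDistLinf {f : Plane → ℝ} (hf : ContDiff ℝ 1 f) {β : ℝ} (hβ : 0 ≤ β)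
    (p q : Plane) : β * |f q - f p| ≤ amoebaDistLinf β f p q := by
  refine le_amoebaDistLinf fun c hc h0 h1 => ?_
  have h := hc.norm_sub_le (φ := fun x => β * f x) (contDiff_const.mul hf) hf (β := β) fun t => by
    have : ((fun x => β * f x) ∘ c) = fun t => β * (f ∘ c) t := rfl
    rw [this, deriv_const_mul_field, norm_mul, Real.norm_eq_abs, Real.norm_eq_abs,
      abs_of_nonneg hβ]
    exact le_max_right _ _
  rw [h0, h1, ← mul_sub, norm_mul, Real.norm_eq_abs, Real.norm_eq_abs, abs_of_nonneg hβ] at h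
  exact h

lemma hasDerivAt_comp_segment {f : Plane → ℝ} (hf : Differentiable ℝ f) (x v : Plane) (t : ℝ) :
    HasDerivAt (fun t : ℝ => f (x + t • v)) (inner ℝ (gradient f (x + t • v)) v) t := by
  have h1 : HasDerivAt (fun t : ℝ => x + t • v) v t := by
    simpa using ((hasDerivAt_id t).smul_const v).const_add x
  have h2 := (hf (x + t • v)).hasGradientAt.hasFDerivAt.comp_hasDerivAt t h1
  simpa [Function.comp_def] using h2

lemma amoebaDistLinf_le {f : Plane → ℝ} (hf : Differentiable ℝ f) (β : ℝ) (x v : Plane) :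
    amoebaDistLinf β f x (x + v) ≤
      ∫ t in (0 : ℝ)..1, max ‖v‖ (β * |inner ℝ (gradient f (x + t • v)) v|) := by
  have hbdd : BddBelow {L | ∃ c : ℝ → Plane, PiecewiseC1 c ∧ c 0 = x ∧ c 1 = x + v ∧
      L = ∫ t in (0:ℝ)..1, max ‖deriv c t‖ (β * |deriv (f ∘ c) t|)} := by
    refine ⟨0, ?_⟩
    rintro L ⟨c, -, -, -, rfl⟩
    exact intervalIntegral.integral_nonneg zero_le_one fun t _ =>
      (norm_nonneg _).trans (le_max_left _ _)
  refine csInf_le hbdd ⟨fun t => x + t • v, piecewiseC1_segment x v, by simp, by simp, ?_⟩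
  congr 1 with t
  have h1 : HasDerivAt (fun t : ℝ => x + t • v) v t := by
    simpa using ((hasDerivAt_id t).smul_const v).const_add x
  rw [h1.deriv, show f ∘ (fun t : ℝ => x + t • v) = fun t : ℝ => f (x + t • v) from rfl,
    (hasDerivAt_comp_segment hf x v t).deriv]

lemma contDiff_gradient {f : Plane → ℝ} {n : ℕ} (hf : ContDiff ℝ (n + 1) f) :
    ContDiff ℝ n (gradient f) := by
  have h : gradient f = fun x => (InnerProductSpace.toDual ℝ Plane).symm (fderiv ℝ f x) := rfl
  rw [h]
  exact (InnerProductSpace.toDual ℝ Plane).symm.contDiff.comp (hf.fderiv_right le_rfl)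

/-- First-order expansion of the gradient with quadratic remainder. -/
lemma exists_gradient_expansion {f : Plane → ℝ} (hf : ContDiff ℝ 3 f) (x₀ : Plane) :
    ∃ K ≥ (0 : ℝ), ∃ r > 0, ∀ v, ‖v‖ ≤ r →
      ‖gradient f (x₀ + v) - gradient f x₀ - fderiv ℝ (gradient f) x₀ v‖ ≤ K * ‖v‖ ^ 2 := by
  have hg : ContDiff ℝ 2 (gradient f) := contDiff_gradient (n := 2) (by exact_mod_cast hf)
  have hg' : ContDiff ℝ 1 (fderiv ℝ (gradient f)) := hg.fderiv_right (by norm_num)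
  obtain ⟨K, s, hs, hK⟩ := (hg'.contDiffAt (x := x₀)).exists_lipschitzOnWith
  obtain ⟨r, hr, hrs⟩ := Metric.nhds_basis_closedBall.mem_iff.1 hs
  refine ⟨K, K.2, r, hr, fun v hv => ?_⟩
  have hsub : Metric.closedBall x₀ ‖v‖ ⊆ s := (Metric.closedBall_subset_closedBall hv).trans hrs
  have h := (convex_closedBall x₀ ‖v‖).norm_image_sub_le_of_norm_hasFDerivWithin_le'
    (f := gradient f) (f' := fderiv ℝ (gradient f)) (φ := fderiv ℝ (gradient f) x₀)
    (C := K * ‖v‖) (x := x₀) (y := x₀ + v)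
    (fun x _ => ((hg.differentiable (by norm_num)) x).hasFDerivAt.hasFDerivWithinAt)
    (fun x hx => by
      refine (hK.norm_sub_le (hsub hx) (mem_of_mem_nhds hs)).trans ?_
      gcongr
      exact mem_closedBall_iff_norm.1 hx)
    (Metric.mem_closedBall_self (norm_nonneg _)) (by simp)
  simp only [add_sub_cancel_left] at h
  rw [pow_two, ← mul_assoc]
  exact h

/-- Second-order expansion with cubic remainder. -/
lemma taylor_of_gradient_expansion {f : Plane → ℝ} (hf : Differentiable ℝ f) {x₀ : Plane}
    {K r : ℝ} (hK : 0 ≤ K) {L : Plane →L[ℝ] Plane}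
    (h : ∀ v, ‖v‖ ≤ r → ‖gradient f (x₀ + v) - gradient f x₀ - L v‖ ≤ K * ‖v‖ ^ 2)
    {v : Plane} (hv : ‖v‖ ≤ r) :
    |f (x₀ + v) - f x₀ - inner ℝ (gradient f x₀) v - inner ℝ (L v) v / 2| ≤ K * ‖v‖ ^ 3 := by
  set g : ℝ → ℝ := fun t => f (x₀ + t • v) - t * inner ℝ (gradient f x₀) v
    - t ^ 2 / 2 * inner ℝ (L v) v with hg
  have hd : ∀ t : ℝ, HasDerivAt g (inner ℝ (gradient f (x₀ + t • v)) v
      - inner ℝ (gradient f x₀) v - t * inner ℝ (L v) v) t := fun t => by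
    have h1 := (hasDerivAt_comp_segment hf x₀ v t).sub
      ((hasDerivAt_id t).mul_const (inner ℝ (gradient f x₀) v))
    have h2 := h1.sub ((((hasDerivAt_id t).pow 2).div_const 2).mul_const (inner ℝ (L v) v))
    refine h2.congr_deriv ?_
    simp
  have hb : ∀ t ∈ Set.Icc (0 : ℝ) 1, ‖inner ℝ (gradient f (x₀ + t • v)) v
      - inner ℝ (gradient f x₀) v - t * inner ℝ (L v) v‖ ≤ K * ‖v‖ ^ 3 := fun t ht => by
    have htv : ‖t • v‖ ≤ ‖v‖ := by
      rw [norm_smul, Real.norm_eq_abs, abs_of_nonneg ht.1]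
      exact mul_le_of_le_one_left (norm_nonneg _) ht.2
    have e : inner ℝ (gradient f (x₀ + t • v)) v - inner ℝ (gradient f x₀) v
        - t * inner ℝ (L v) v
        = inner ℝ (gradient f (x₀ + t • v) - gradient f x₀ - L (t • v)) v := by
      rw [map_smul, inner_sub_left, inner_sub_left, real_inner_smul_left]
    rw [e]
    calc _ ≤ ‖gradient f (x₀ + t • v) - gradient f x₀ - L (t • v)‖ * ‖v‖ := norm_inner_le_norm _ _
      _ ≤ (K * ‖t • v‖ ^ 2) * ‖v‖ := by gcongr; exact h _ (htv.trans hv)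
      _ ≤ (K * ‖v‖ ^ 2) * ‖v‖ := by gcongr
      _ = _ := by ring
  have := (convex_Icc (0 : ℝ) 1).norm_image_sub_le_of_norm_hasDerivWithin_le
    (fun t _ => (hd t).hasDerivWithinAt) hb (Set.left_mem_Icc.2 zero_le_one)
    (Set.right_mem_Icc.2 zero_le_one)
  rw [sub_zero, norm_one, mul_one, Real.norm_eq_abs] at this
  refine le_of_eq_of_le ?_ this
  congr 1
  simp only [hg]
  simp
  ring

lemma rpow_three_halves (w : ℝ) : w ^ ((3 : ℝ) / 2) = √w ^ 3 := by
  rcases le_or_gt 0 w with h | h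
  · rw [Real.sqrt_eq_rpow, ← Real.rpow_natCast, ← Real.rpow_mul h]
    norm_num
  · rw [Real.rpow_def_of_neg h, Real.sqrt_eq_zero_of_nonpos h.le,
      show (3 : ℝ) / 2 * Real.pi = Real.pi / 2 + Real.pi by ring, Real.cos_add_pi,
      Real.cos_pi_div_two]
    simp

lemma gLinf_eq {β z : ℝ} (hβ : 0 < β) (hz : 0 < z) :
    gLinf β z = 1 - (1 - 1 / (β ^ 2 * z ^ 2)) ^ ((3 : ℝ) / 2) := by
  unfold gLinf
  split_ifs with h
  · have : 1 - 1 / (β ^ 2 * z ^ 2) ≤ 0 := by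
      rw [sub_nonpos, le_div_iff₀ (by positivity)]
      have : 0 < β * z := by positivity
      nlinarith
    rw [rpow_three_halves, Real.sqrt_eq_zero_of_nonpos this]
    norm_num
  · rfl

lemma hasDerivAt_gLinf {β z : ℝ} (hβ : 0 < β) (hz : 0 < z) :
    HasDerivAt (gLinf β) (-3 * √(1 - (1 / (β * z)) ^ 2) * (1 / (β * z)) ^ 2 / z) z := by
  have h1 : HasDerivAt (fun z : ℝ => 1 - 1 / (β ^ 2 * z ^ 2)) (2 / (β ^ 2 * z ^ 3)) z := by
    have := (((hasDerivAt_pow 2 z).const_mul (β ^ 2)).inv (by positivity)).const_sub 1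
    simp only [one_div]
    refine this.congr_deriv ?_
    field_simp
    norm_num [mul_comm]
  have h2 := (Real.hasDerivAt_rpow_const (x := 1 - 1 / (β ^ 2 * z ^ 2)) (p := 3 / 2)
    (Or.inr (by norm_num))).comp z h1
  have h3 := h2.const_sub 1
  refine (h3.congr_of_eventuallyEq ?_).congr_deriv ?_
  · filter_upwards [eventually_gt_nhds hz] with w hw
    exact gLinf_eq hβ hw
  · rw [show (3 : ℝ) / 2 - 1 = 1 / 2 by norm_num, ← Real.sqrt_eq_rpow,
      show 1 - 1 / (β ^ 2 * z ^ 2) = 1 - (1 / (β * z)) ^ 2 by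
        rw [div_pow, mul_pow, one_pow]]
    field_simp

lemma div2_eq_trace {V : Plane → Plane} {x : Plane} {V' : Plane →L[ℝ] Plane}
    (hV : HasFDerivAt V V' x) : div2 V x = LinearMap.trace ℝ Plane V' := by
  rw [LinearMap.trace_eq_sum_inner _ (EuclideanSpace.basisFun (Fin 2) ℝ)]
  unfold div2
  refine Finset.sum_congr rfl fun i _ => ?_
  have h : HasFDerivAt (fun y => V y i) ((EuclideanSpace.proj i : Plane →L[ℝ] ℝ).comp V') x :=
    (EuclideanSpace.proj i : Plane →L[ℝ] ℝ).hasFDerivAt.comp x hV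
  rw [h.fderiv]
  simp [EuclideanSpace.inner_single_left]

/-- The self-snakes operator in a frame whose vector `b 1` points along the gradient. -/
lemma selfSnakes_eq {g : Plane → Plane} {x : Plane} {L : Plane →L[ℝ] Plane}
    (hg : HasFDerivAt g L x) (h0 : g x ≠ 0) {β : ℝ} (hβ : 0 < β)
    (b : OrthonormalBasis (Fin 2) ℝ Plane) (hb : g x = ‖g x‖ • b 1) :
    ‖g x‖ * div2 (fun y => (gLinf β ‖g y‖ / ‖g y‖) • g y) x =
      (1 - √(1 - (1 / (β * ‖g x‖)) ^ 2) ^ 3) * inner ℝ (b 0) (L (b 0))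
      - 3 * √(1 - (1 / (β * ‖g x‖)) ^ 2) * (1 / (β * ‖g x‖)) ^ 2 * inner ℝ (b 1) (L (b 1)) := by
  have hz : 0 < ‖g x‖ := norm_pos_iff.2 h0
  have hn : HasFDerivAt (fun y => ‖g y‖) ((1 / ‖g x‖) • (innerSL ℝ (g x)).comp L) x := by
    have := hg.norm_sq.sqrt (by positivity)
    simp only [Real.sqrt_sq (norm_nonneg _)] at this
    refine this.congr_fderiv ?_
    rw [← Nat.cast_smul_eq_nsmul ℝ, smul_smul]
    congr 1
    field_simp
    norm_num
  have hG := (hasDerivAt_gLinf hβ hz).div (hasDerivAt_id ‖g x‖) hz.ne'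
  have hV := (hG.comp_hasFDerivAt x hn).smul hg
  have hV : HasFDerivAt (fun y => (gLinf β ‖g y‖ / ‖g y‖) • g y) _ x := hV
  rw [div2_eq_trace hV, LinearMap.trace_eq_sum_inner _ b, Fin.sum_univ_two]
  have hgz := gLinf_eq hβ hz
  rw [rpow_three_halves, show 1 - 1 / (β ^ 2 * ‖g x‖ ^ 2) = 1 - (1 / (β * ‖g x‖)) ^ 2 by
        rw [div_pow, mul_pow, one_pow]] at hgz
  have b01 : inner ℝ (b 0) (b 1) = 0 := by simp
  have b11 : inner ℝ (b 1) (b 1) = (1 : ℝ) := by simp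
  set z := ‖g x‖ with hzdef
  have g0 : inner ℝ (b 0) (g x) = 0 := by rw [hb, real_inner_smul_right, b01, mul_zero]
  have g1 : inner ℝ (b 1) (g x) = z := by rw [hb, real_inner_smul_right, b11, mul_one]
  have gl : ∀ v, inner ℝ (g x) v = z * inner ℝ (b 1) v := fun v => by
    rw [hb, real_inner_smul_left]
  simp only [ContinuousLinearMap.coe_coe, add_apply,
    smul_apply, ContinuousLinearMap.smulRight_apply,
    ContinuousLinearMap.comp_apply, innerSL_apply_apply, Function.comp_apply, Pi.div_apply, id, inner_add_right, real_inner_smul_right,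
    g0, g1, gl, smul_eq_mul]
  rw [hgz]
  field_simp
  ring

/-- The rescaled orthonormal coordinates centred at `x₀`. -/
def frameMap (b : OrthonormalBasis (Fin 2) ℝ Plane) (x₀ : Plane) (ρ : ℝ) (w : ℝ × ℝ) : Plane :=
  x₀ + ρ • (w.1 • b 0 + w.2 • b 1)

lemma volume_eq_frameMap (b : OrthonormalBasis (Fin 2) ℝ Plane) (x₀ : Plane) {ρ : ℝ} (hρ : 0 < ρ)
    (A : Set Plane) :
    volume A = ENNReal.ofReal (ρ ^ 2) * volume (frameMap b x₀ ρ ⁻¹' A) := by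
  set e : ℝ × ℝ ≃ᵐ Plane := (MeasurableEquiv.finTwoArrow.symm.trans
    (MeasurableEquiv.toLp 2 (Fin 2 → ℝ))).trans b.repr.symm.toMeasurableEquiv with he
  have hmp : MeasurePreserving e volume volume :=
    b.measurePreserving_repr_symm.comp ((PiLp.volume_preserving_toLp (Fin 2)).comp
      (volume_preserving_finTwoArrow ℝ).symm)
  have hew : ∀ w : ℝ × ℝ, e w = w.1 • b 0 + w.2 • b 1 := fun w => by
    have := b.sum_repr_symm (WithLp.toLp 2 ![w.1, w.2])
    rw [Fin.sum_univ_two] at this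
    exact this.symm
  have hpre : frameMap b x₀ ρ ⁻¹' A = e ⁻¹' ((fun v => ρ • v) ⁻¹' ((fun v => x₀ + v) ⁻¹' A)) := by
    ext w
    simp only [Set.mem_preimage, hew, frameMap]
  rw [hpre, hmp.measure_preimage_equiv, Measure.addHaar_preimage_smul _ hρ.ne',
    measure_preimage_add, finrank_euclideanSpace_fin, abs_of_pos (by positivity), ← mul_assoc,
    ← ENNReal.ofReal_mul (by positivity), mul_inv_cancel₀ (by positivity), ENNReal.ofReal_one,
    one_mul]

lemma amoebaDistLinf_le_of_bound {f : Plane → ℝ} (hf : Differentiable ℝ f) {β ρ : ℝ}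
    {x v : Plane} (hv : ‖v‖ ≤ ρ)
    (h : ∀ t ∈ Set.Icc (0 : ℝ) 1, β * |inner ℝ (gradient f (x + t • v)) v| ≤ ρ) :
    amoebaDistLinf β f x (x + v) ≤ ρ := by
  refine (amoebaDistLinf_le hf β x v).trans ((le_abs_self _).trans ?_)
  have := intervalIntegral.norm_integral_le_of_norm_le_const (a := 0) (b := 1) (C := ρ)
    (f := fun t : ℝ => max ‖v‖ (β * |inner ℝ (gradient f (x + t • v)) v|)) fun t ht => by
      rw [Set.uIoc_of_le zero_le_one] at ht
      rw [Real.norm_eq_abs, abs_of_nonneg ((norm_nonneg v).trans (le_max_left _ _))]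
      exact max_le hv (h t (Set.Ioc_subset_Icc_self ht))
  simpa using this

lemma amoebaDistLinf_le_of_monotone {f : Plane → ℝ} (hf : ContDiff ℝ 1 f) {β σ : ℝ} (hβ : 0 < β)
    (hσ : |σ| = 1) {x v : Plane}
    (h : ∀ t ∈ Set.Icc (0 : ℝ) 1, ‖v‖ ≤ β * (σ * inner ℝ (gradient f (x + t • v)) v)) :
    amoebaDistLinf β f x (x + v) ≤ β * |f (x + v) - f x| := by
  have hd : Differentiable ℝ f := hf.differentiable one_ne_zero
  refine (amoebaDistLinf_le hd β x v).trans ?_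
  have hg : Continuous (gradient f) := (contDiff_gradient (n := 0) (by simpa using hf)).continuous
  have h_int : ∫ t in (0 : ℝ)..1, inner ℝ (gradient f (x + t • v)) v = f (x + v) - f x := by
    rw [intervalIntegral.integral_eq_sub_of_hasDerivAt
      (fun t _ => hasDerivAt_comp_segment hd x v t)
      (Continuous.intervalIntegrable (by fun_prop) _ _)]
    simp
  have e : ∫ t in (0 : ℝ)..1, max ‖v‖ (β * |inner ℝ (gradient f (x + t • v)) v|)
      = ∫ t in (0 : ℝ)..1, β * (σ * inner ℝ (gradient f (x + t • v)) v) := by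
    refine intervalIntegral.integral_congr fun t ht => ?_
    rw [Set.uIcc_of_le zero_le_one] at ht
    have h1 := h t ht
    have h2 : 0 ≤ σ * inner ℝ (gradient f (x + t • v)) v :=
      nonneg_of_mul_nonneg_right ((norm_nonneg v).trans h1) hβ
    have h3 : |inner ℝ (gradient f (x + t • v)) v| = σ * inner ℝ (gradient f (x + t • v)) v := by
      rw [← abs_of_nonneg h2, abs_mul, hσ, one_mul]
    simp only [h3]
    exact max_eq_right h1
  rw [e, intervalIntegral.integral_const_mul, intervalIntegral.integral_const_mul, h_int]
  gcongr
  calc σ * (f (x + v) - f x) ≤ |σ * (f (x + v) - f x)| := le_abs_self _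
    _ = |f (x + v) - f x| := by rw [abs_mul, hσ, one_mul]

/-- A displacement `v` lies in the amoeba as soon as it satisfies the two obvious necessary
conditions and stays away from the transition zone; here `s` approximates the directional
derivative of `f` along the segment. -/
lemma amoebaDistLinf_le_of_not_transition {f : Plane → ℝ} (hf : ContDiff ℝ 1 f) {β ρ s δ : ℝ}
    (hβ : 0 < β) {x v : Plane} (hv : ‖v‖ ≤ ρ) (hfv : β * |f (x + v) - f x| ≤ ρ)
    (hs : ∀ t ∈ Set.Icc (0 : ℝ) 1, |inner ℝ (gradient f (x + t • v)) v - s| ≤ δ)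
    (h : ‖v‖ + 2 * (β * δ) ≤ ρ ∨ β * δ ≤ |(β * |s| - ‖v‖)|) :
    amoebaDistLinf β f x (x + v) ≤ ρ := by
  have hd : Differentiable ℝ f := hf.differentiable one_ne_zero
  have hup : ∀ t ∈ Set.Icc (0 : ℝ) 1,
      β * |inner ℝ (gradient f (x + t • v)) v| ≤ β * |s| + β * δ := fun t ht => by
    rw [← mul_add]
    gcongr
    have := abs_sub_abs_le_abs_sub (inner ℝ (gradient f (x + t • v)) v) s
    linarith [hs t ht]
  rcases le_or_gt (β * |s| + β * δ) ρ with h1 | h1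
  · exact amoebaDistLinf_le_of_bound hd hv fun t ht => (hup t ht).trans h1
  have h2 : ‖v‖ + β * δ ≤ β * |s| := by
    rcases h with h | h
    · linarith
    · rcases le_abs.1 h with h | h <;> linarith
  obtain ⟨σ, hσ, hσs⟩ : ∃ σ : ℝ, |σ| = 1 ∧ σ * s = |s| := by
    rcases abs_choice s with e | e
    · exact ⟨1, by simp, by rw [e, one_mul]⟩
    · exact ⟨-1, by simp, by rw [e]; ring⟩
  refine (amoebaDistLinf_le_of_monotone hf hβ hσ fun t ht => ?_).trans hfv
  have h3 : |σ * (inner ℝ (gradient f (x + t • v)) v - s)| ≤ δ := by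
    rw [abs_mul, hσ, one_mul]; exact hs t ht
  have h4 : |s| - δ ≤ σ * inner ℝ (gradient f (x + t • v)) v := by
    rw [← hσs]
    have := (abs_le.1 h3).1
    linarith
  have := mul_le_mul_of_nonneg_left h4 hβ.le
  linarith

lemma exists_frame {g : Plane} (hg : g ≠ 0) :
    ∃ b : OrthonormalBasis (Fin 2) ℝ Plane, g = ‖g‖ • b 1 := by
  have hz : ‖g‖ ≠ 0 := norm_ne_zero_iff.2 hg
  have ho : Orthonormal ℝ (({1} : Set (Fin 2)).domRestrict fun _ => ‖g‖⁻¹ • g) := by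
    refine ⟨fun _ => ?_, fun i j hij => absurd (Subsingleton.elim i j) hij⟩
    change ‖‖g‖⁻¹ • g‖ = 1
    rw [norm_smul, norm_inv, norm_norm, inv_mul_cancel₀ hz]
  obtain ⟨b, hb⟩ := ho.exists_orthonormalBasis_extension_of_card_eq (by simp)
  refine ⟨b, ?_⟩
  rw [hb 1 rfl, smul_inv_smul₀ hz]

lemma norm_frame_sq (b : OrthonormalBasis (Fin 2) ℝ Plane) (y x : ℝ) :
    ‖y • b 0 + x • b 1‖ ^ 2 = x ^ 2 + y ^ 2 := by
  have h01 : inner ℝ (b 0) (b 1) = (0 : ℝ) := by simp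
  rw [norm_add_sq_real, norm_smul, norm_smul, real_inner_smul_left, real_inner_smul_right, h01]
  simp
  ring

lemma eventually_median_lt {f : Plane → ℝ} (hf : ContDiff ℝ 3 f) {x₀ : Plane}
    (hgrad : gradient f x₀ ≠ 0) {β : ℝ} (hβ : 0 < β) {m : ℝ → ℝ}
    (hm : ∀ ρ > 0, IsMedian f (amoebaLinf β f x₀ ρ) (m ρ)) {c : ℝ}
    (hc : ‖gradient f x₀‖ *
      div2 (fun x => (gLinf β ‖gradient f x‖ / ‖gradient f x‖) • gradient f x) x₀ / 6 < c) :
    ∀ᶠ ρ in 𝓝[>] (0 : ℝ), m ρ < f x₀ + c * ρ ^ 2 := by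
  have hf1 : ContDiff ℝ 1 f := hf.of_le (by norm_num)
  have hd : Differentiable ℝ f := hf1.differentiable one_ne_zero
  have hg2 : ContDiff ℝ 2 (gradient f) := contDiff_gradient (n := 2) (by exact_mod_cast hf)
  set L := fderiv ℝ (gradient f) x₀ with hL
  have hgL : HasFDerivAt (gradient f) L x₀ := (hg2.differentiable two_ne_zero x₀).hasFDerivAt
  obtain ⟨b, hb⟩ := exists_frame hgrad
  obtain ⟨K, hK, r, hr, hexp⟩ := exists_gradient_expansion hf x₀
  rw [selfSnakes_eq hgL hgrad hβ b hb] at hc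
  set z := ‖gradient f x₀‖ with hz'
  have hz : 0 < z := norm_pos_iff.2 hgrad
  set p := 1 / (β * z) with hp'
  have hp : 0 < p := by positivity
  have hzp : z * p = 1 / β := by rw [hp']; field_simp
  set K₁ := K * r + ‖L‖ with hK₁
  have hK₁0 : 0 ≤ K₁ := by positivity
  set K' := K + K₁ / z + 2 * (β * K₁) with hK'
  set u : ℝ → ℝ → Plane := fun y x => y • b 0 + x • b 1 with hu
  have hGu : ∀ y x, inner ℝ (gradient f x₀) (u y x) = z * x := fun y x => by
    have h01 : inner ℝ (b 1) (b 0) = (0 : ℝ) := by simp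
    have h11 : inner ℝ (b 1) (b 1) = (1 : ℝ) := by simp
    rw [hb]
    simp only [hu, inner_add_right, real_inner_smul_left, real_inner_smul_right, h01, h11]
    ring
  have hnu : ∀ y x, ‖u y x‖ = √(x ^ 2 + y ^ 2) := fun y x => by
    rw [← norm_frame_sq b, Real.sqrt_sq (norm_nonneg _)]
  have hρr : ∀ᶠ ρ in 𝓝[>] (0 : ℝ), 0 < ρ ∧ ρ ≤ r := by
    filter_upwards [self_mem_nhdsWithin,
      eventually_nhdsWithin_of_eventually_nhds (eventually_le_nhds hr)] with ρ h1 h2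
    exact ⟨h1, h2⟩
  have hnρ : ∀ ρ > 0, ∀ y x, ‖ρ • u y x‖ = ρ * √(x ^ 2 + y ^ 2) := fun ρ hρ y x => by
    rw [norm_smul, hnu, Real.norm_eq_abs, abs_of_pos hρ]
  have key := eventually_half_volume_lt (z := z) (p := p) (K := K') hz hp (by positivity)
    (N := inner ℝ (b 1) (L (b 1))) (M := (inner ℝ (b 0) (L (b 1)) + inner ℝ (b 1) (L (b 0))) / 2)
    (T := inner ℝ (b 0) (L (b 0))) (c := c)
    (F := fun ρ y x => (f (frameMap b x₀ ρ (y, x)) - f x₀) / ρ)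
    (S := fun ρ => frameMap b x₀ ρ ⁻¹' amoebaLinf β f x₀ ρ) ?_ ?_ ?_ ?_
  · filter_upwards [key, self_mem_nhdsWithin] with ρ hkey hρ
    have hρ : 0 < ρ := hρ
    by_contra! hcon
    refine (hm ρ hρ).1.not_gt ?_
    have hsub : {w ∈ frameMap b x₀ ρ ⁻¹' amoebaLinf β f x₀ ρ |
        (f (frameMap b x₀ ρ (w.1, w.2)) - f x₀) / ρ < ρ * c} ⊆
        frameMap b x₀ ρ ⁻¹' {x ∈ amoebaLinf β f x₀ ρ | f x < m ρ} := by
      rintro w ⟨hw1, hw2⟩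
      refine ⟨hw1, ?_⟩
      rw [div_lt_iff₀ hρ] at hw2
      change f (frameMap b x₀ ρ (w.1, w.2)) < m ρ
      linarith
    have h1 := hkey.trans_le (measure_mono hsub)
    have hρ2 : ENNReal.ofReal (ρ ^ 2) ≠ 0 := by
      rw [ne_eq, ENNReal.ofReal_eq_zero, not_le]; positivity
    rw [volume_eq_frameMap b x₀ hρ, volume_eq_frameMap b x₀ hρ, mul_div_assoc]
    exact (ENNReal.mul_lt_mul_iff_right hρ2 ENNReal.ofReal_ne_top).2 h1
  · filter_upwards [hρr] with ρ hρ x y hxy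
    obtain ⟨hρ, hρr⟩ := hρ
    have hs1 : √(x ^ 2 + y ^ 2) ≤ 1 := Real.sqrt_le_one.2 hxy
    have hv : ‖ρ • u y x‖ ≤ ρ := by
      rw [hnρ ρ hρ]; exact mul_le_of_le_one_right hρ.le hs1
    have ht := taylor_of_gradient_expansion hd hK hexp (hv.trans hρr)
    have e1 : inner ℝ (L (ρ • u y x)) (ρ • u y x) / 2 =
        ρ ^ 2 * halfQuad (inner ℝ (b 1) (L (b 1)))
          ((inner ℝ (b 0) (L (b 1)) + inner ℝ (b 1) (L (b 0))) / 2)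
          (inner ℝ (b 0) (L (b 0))) x y := by
      simp only [hu, halfQuad, map_smul, map_add, inner_add_left, inner_add_right,
        real_inner_smul_left, real_inner_smul_right, real_inner_comm _ (L _)]
      ring
    rw [e1, real_inner_smul_right, hGu] at ht
    have e2 : (f (x₀ + ρ • u y x) - f x₀) / ρ - z * x - ρ * halfQuad (inner ℝ (b 1) (L (b 1)))
          ((inner ℝ (b 0) (L (b 1)) + inner ℝ (b 1) (L (b 0))) / 2)
          (inner ℝ (b 0) (L (b 0))) x y =
        (f (x₀ + ρ • u y x) - f x₀ - ρ * (z * x) - ρ ^ 2 * halfQuad (inner ℝ (b 1) (L (b 1)))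
          ((inner ℝ (b 0) (L (b 1)) + inner ℝ (b 1) (L (b 0))) / 2)
          (inner ℝ (b 0) (L (b 0))) x y) / ρ := by
      field_simp
    change |(f (x₀ + ρ • u y x) - f x₀) / ρ - z * x - _| ≤ _
    rw [e2, abs_div, abs_of_pos hρ, div_le_iff₀ hρ]
    refine ht.trans ?_
    calc K * ‖ρ • u y x‖ ^ 3 ≤ K' * ρ ^ 3 := by
          gcongr
          have : 0 ≤ K₁ / z + 2 * (β * K₁) := by positivity
          linarith
      _ = _ := by ring
  · filter_upwards [hρr] with ρ hρ x y hyx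
    obtain ⟨hρ, hρr⟩ := hρ
    have hyx : amoebaDistLinf β f x₀ (x₀ + ρ • u y x) ≤ ρ := hyx
    have h1 := (norm_sub_le_amoebaDistLinf hf1 β _ _).trans hyx
    have h2 := (abs_sub_le_amoebaDistLinf hf1 hβ.le _ _).trans hyx
    rw [add_sub_cancel_left, hnρ ρ hρ, mul_le_iff_le_one_right hρ] at h1
    refine ⟨Real.sqrt_le_one.1 h1, ?_⟩
    change |(f (x₀ + ρ • u y x) - f x₀) / ρ| ≤ _
    rw [hzp, abs_div, abs_of_pos hρ, div_le_div_iff₀ hρ hβ]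
    linarith
  · filter_upwards [hρr] with ρ hρ x y hxy hFx hzone
    obtain ⟨hρ, hρr⟩ := hρ
    have hs1 : √(x ^ 2 + y ^ 2) ≤ 1 := Real.sqrt_le_one.2 hxy
    have hv : ‖ρ • u y x‖ ≤ ρ := by
      rw [hnρ ρ hρ]; exact mul_le_of_le_one_right hρ.le hs1
    replace hFx : |(f (x₀ + ρ • u y x) - f x₀) / ρ| ≤ z * p := hFx
    rw [hzp, abs_div, abs_of_pos hρ, div_le_div_iff₀ hρ hβ] at hFx
    change amoebaDistLinf β f x₀ (x₀ + ρ • u y x) ≤ ρ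
    refine amoebaDistLinf_le_of_not_transition hf1 (s := ρ * (z * x)) (δ := K₁ * ρ ^ 2) hβ
      hv (by linarith) (fun t ht => ?_) ?_
    · have htv : ‖t • ρ • u y x‖ ≤ ‖ρ • u y x‖ := by
        rw [norm_smul t, Real.norm_eq_abs, abs_of_nonneg ht.1]
        exact mul_le_of_le_one_left (norm_nonneg _) ht.2
      have htρ := htv.trans hv
      have h1 : ‖gradient f (x₀ + t • ρ • u y x) - gradient f x₀‖ ≤ K₁ * ρ := by
        calc _ ≤ ‖gradient f (x₀ + t • ρ • u y x) - gradient f x₀ - L (t • ρ • u y x)‖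
              + ‖L (t • ρ • u y x)‖ := by
                simpa using norm_add_le
                  (gradient f (x₀ + t • ρ • u y x) - gradient f x₀ - L (t • ρ • u y x))
                  (L (t • ρ • u y x))
          _ ≤ K * ‖t • ρ • u y x‖ ^ 2 + ‖L‖ * ‖t • ρ • u y x‖ :=
            add_le_add (hexp _ (htρ.trans hρr)) (L.le_opNorm _)
          _ ≤ K * (r * ρ) + ‖L‖ * ρ := by
            rw [pow_two]
            gcongr
            exact htρ.trans hρr
          _ = K₁ * ρ := by rw [hK₁]; ring
      have e : inner ℝ (gradient f (x₀ + t • ρ • u y x)) (ρ • u y x) - ρ * (z * x)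
          = inner ℝ (gradient f (x₀ + t • ρ • u y x) - gradient f x₀) (ρ • u y x) := by
        rw [inner_sub_left, real_inner_smul_right (gradient f x₀) (u y x) ρ, hGu]
      rw [e]
      calc _ ≤ ‖gradient f (x₀ + t • ρ • u y x) - gradient f x₀‖ * ‖ρ • u y x‖ :=
            abs_real_inner_le_norm _ _
        _ ≤ (K₁ * ρ) * ρ := by gcongr
        _ = K₁ * ρ ^ 2 := by ring
    · rw [hnρ ρ hρ]
      set q := √(x ^ 2 + y ^ 2)
      rcases hzone with h | h
      · left
        have h1 : q ≤ 1 - 2 * (β * K₁) * ρ := by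
          have : 2 * (β * K₁) * ρ ≤ K' * ρ := by
            gcongr
            have : 0 ≤ K + K₁ / z := by positivity
            linarith
          linarith
        have := mul_le_mul_of_nonneg_left h1 hρ.le
        linarith
      · right
        have e : β * |ρ * (z * x)| - ρ * q = (β * z * ρ) * (|x| - p * q) := by
          rw [abs_mul, abs_mul, abs_of_pos hρ, abs_of_pos hz, hp']
          field_simp
        rw [e, abs_mul, abs_of_pos (show 0 < β * z * ρ by positivity)]
        have h1 : K₁ / z * ρ ≤ K' * ρ := by
          gcongr
          have : 0 ≤ K + 2 * (β * K₁) := by positivity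
          linarith
        calc β * (K₁ * ρ ^ 2) = (β * z * ρ) * (K₁ / z * ρ) := by field_simp
          _ ≤ _ := by gcongr; exact h1.trans h
  · exact hc

lemma gradient_neg_fun (f : Plane → ℝ) : gradient (-f) = -gradient f := by
  ext1 x
  simp [gradient, fderiv_neg]

lemma amoebaLinf_neg (β : ℝ) (f : Plane → ℝ) (x₀ : Plane) (ρ : ℝ) :
    amoebaLinf β (-f) x₀ ρ = amoebaLinf β f x₀ ρ := by
  have h : ∀ (c : ℝ → Plane) (t : ℝ), |deriv ((-f) ∘ c) t| = |deriv (f ∘ c) t| := fun c t => by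
    have : (-f) ∘ c = -(f ∘ c) := rfl
    rw [this, deriv.neg, abs_neg]
  simp only [amoebaLinf, amoebaDistLinf, h]

lemma IsMedian.neg {u : Plane → ℝ} {A : Set Plane} {m : ℝ} (h : IsMedian u A m) :
    IsMedian (-u) A (-m) := by
  simp only [IsMedian, Pi.neg_apply, neg_lt_neg_iff]
  exact h.symm

lemma div2_neg (V : Plane → Plane) (x : Plane) : div2 (-V) x = -div2 V x := by
  unfold div2
  rw [← Finset.sum_neg_distrib]
  refine Finset.sum_congr rfl fun i _ => ?_
  have : (fun y => (-V) y i) = -fun y => V y i := rfl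
  rw [this, fderiv_neg]
  rfl

/-- Amoeba median filtering with the L∞ (maximum) amoeba metric approximates a
time step of size ρ²/6 of the self-snakes PDE with edge-stopping function g_∞. -/
theorem amoeba_median_Linf_approximates_self_snakes
    (f : Plane → ℝ) (hf : ContDiff ℝ 3 f) (x₀ : Plane)
    (hgrad : gradient f x₀ ≠ 0)
    (β : ℝ) (hβ : 0 < β)
    (m : ℝ → ℝ)
    (hm : ∀ ρ > 0, IsMedian f (amoebaLinf β f x₀ ρ) (m ρ)) :
    (fun ρ : ℝ => m ρ - f x₀ - ρ ^ 2 / 6 *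
        (‖gradient f x₀‖ *
          div2 (fun x => (gLinf β ‖gradient f x‖ / ‖gradient f x‖) • gradient f x) x₀))
      =o[𝓝[>] 0] (fun ρ : ℝ => ρ ^ 2) := by
  rw [isLittleO_iff]
  intro ε hε
  set P := ‖gradient f x₀‖ *
    div2 (fun x => (gLinf β ‖gradient f x‖ / ‖gradient f x‖) • gradient f x) x₀ with hP
  have h1 := eventually_median_lt hf hgrad hβ hm (c := P / 6 + ε) (by rw [← hP]; linarith)
  have hPneg : ‖gradient (-f) x₀‖ * div2 (fun x => (gLinf β ‖gradient (-f) x‖ /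
      ‖gradient (-f) x‖) • gradient (-f) x) x₀ = -P := by
    have : (fun x => (gLinf β ‖gradient (-f) x‖ / ‖gradient (-f) x‖) • gradient (-f) x) =
        -fun x => (gLinf β ‖gradient f x‖ / ‖gradient f x‖) • gradient f x := by
      ext1 x
      simp only [gradient_neg_fun, Pi.neg_apply, norm_neg, smul_neg]
    rw [this, div2_neg, gradient_neg_fun, Pi.neg_apply, norm_neg, mul_neg]
  have h2 := eventually_median_lt (f := -f) (m := fun ρ => -m ρ) (c := -P / 6 + ε) hf.neg
    (by rw [gradient_neg_fun]; simpa using hgrad) hβ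
    (fun ρ hρ => by rw [amoebaLinf_neg]; exact (hm ρ hρ).neg) (by rw [hPneg]; linarith)
  filter_upwards [h1, h2] with ρ h1 h2
  rw [Pi.neg_apply] at h2
  rw [Real.norm_eq_abs, Real.norm_eq_abs, abs_of_nonneg (sq_nonneg ρ), abs_le]
  constructor <;> linarith
end
end

section
/- Let u : ℝ² → ℝ be twice continuously differentiable and x₀ a point with ∇u(x₀) ≠ 0, and let β > 0. Consider the Euclidean amoeba distance built from u itself and the amoebas A_ρ(u; x₀). Then, as ρ → 0⁺, sup over A_ρ(u; x₀) of u equals u(x₀) + ρ·|∇u(x₀)|/√(1 + β²|∇u(x₀)|²) + o(ρ), and inf over A_ρ(u; x₀) of u equals u(x₀) − ρ·|∇u(x₀)|/√(1 + β²|∇u(x₀)|²) + o(ρ). (One step of amoeba dilation or erosion approximates a time step of size ρ of the Hamilton–Jacobi-type PDE u_t = ± |∇u|/√(1 + β²|∇u|²).) -/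
open MeasureTheory Asymptotics Filter Topology

noncomputable section

/-- the Euclidean amoeba distance on the image `f`:
d(p,q) = inf over piecewise C¹ curves of ∫₀¹ √(‖c'(t)‖² + β²((f∘c)'(t))²) dt -/
def amoebaDistE (β : ℝ) (f : Plane → ℝ) (p q : Plane) : ℝ :=
  sInf {L | ∃ c : ℝ → Plane, PiecewiseC1 c ∧ c 0 = p ∧ c 1 = q ∧
    L = ∫ t in (0:ℝ)..1, Real.sqrt (‖deriv c t‖ ^ 2 + β ^ 2 * (deriv (f ∘ c) t) ^ 2)}

/-- the Euclidean-metric amoeba of radius ρ around x₀ -/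
def amoebaE (β : ℝ) (f : Plane → ℝ) (x₀ : Plane) (ρ : ℝ) : Set Plane :=
  {y | amoebaDistE β f x₀ y ≤ ρ}

/-- Membership in an interior of a cell of a partition, away from its nodes. -/
lemma exists_mem_Ioo_of_notMem_range {n : ℕ} {t : ℕ → ℝ} {x : ℝ} (h0 : t 0 < x) (hn : x < t n)
    (hx : x ∉ Set.range t) : ∃ i < n, x ∈ Set.Ioo (t i) (t (i + 1)) := by
  induction n with
  | zero => exact absurd h0 (not_lt.2 hn.le)
  | succ k ih =>
    rcases lt_trichotomy x (t k) with h | h | h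
    · obtain ⟨i, hi, hmem⟩ := ih h
      exact ⟨i, hi.trans k.lt_succ_self, hmem⟩
    · exact absurd ⟨k, h.symm⟩ hx
    · exact ⟨k, k.lt_succ_self, h, hn⟩

lemma ContDiffOn.intervalIntegrable_deriv {E : Type*} [NormedAddCommGroup E] [NormedSpace ℝ E]
    {c : ℝ → E} {a b : ℝ} (hab : a < b) (hc : ContDiffOn ℝ 1 c (Set.Icc a b)) :
    IntervalIntegrable (deriv c) volume a b := by
  have h1 : IntervalIntegrable (derivWithin c (Set.Icc a b)) volume a b :=
    (hc.continuousOn_derivWithin (uniqueDiffOn_Icc hab) le_rfl).intervalIntegrable_of_Icc hab.le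
  refine h1.congr_uIoo fun x hx => ?_
  rw [Set.uIoo_of_le hab.le] at hx
  exact derivWithin_of_mem_nhds (Icc_mem_nhds hx.1 hx.2)

lemma intervalIntegrable_deriv_of_piecewise {E : Type*} [NormedAddCommGroup E] [NormedSpace ℝ E]
    {c : ℝ → E} {n : ℕ} {t : ℕ → ℝ} (ht : ∀ i < n, t i < t (i + 1))
    (hc : ∀ i < n, ContDiffOn ℝ 1 c (Set.Icc (t i) (t (i + 1)))) :
    IntervalIntegrable (deriv c) volume (t 0) (t n) :=
  IntervalIntegrable.trans_iterate fun i hi => (hc i hi).intervalIntegrable_deriv (ht i hi)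

namespace PiecewiseC1

variable {c : ℝ → Plane}

lemma intervalIntegrable_deriv (hc : PiecewiseC1 c) :
    IntervalIntegrable (deriv c) volume 0 1 := by
  obtain ⟨-, n, t, h0, hn, ht, hd⟩ := hc
  simpa [h0, hn] using intervalIntegrable_deriv_of_piecewise ht hd

lemma intervalIntegrable_deriv_comp (hc : PiecewiseC1 c) {u : Plane → ℝ} (hu : ContDiff ℝ 1 u) :
    IntervalIntegrable (deriv (u ∘ c)) volume 0 1 := by
  obtain ⟨-, n, t, h0, hn, ht, hd⟩ := hc
  simpa [h0, hn] using
    intervalIntegrable_deriv_of_piecewise ht fun i hi => hu.comp_contDiffOn (hd i hi)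

lemma exists_countable_differentiableAt (hc : PiecewiseC1 c) :
    ∃ s : Set ℝ, s.Countable ∧ ∀ x ∈ Set.Ioo (0 : ℝ) 1 \ s, DifferentiableAt ℝ c x := by
  obtain ⟨-, n, t, h0, hn, -, hd⟩ := hc
  refine ⟨Set.range t, Set.countable_range t, fun x hx => ?_⟩
  obtain ⟨i, hi, hmem⟩ :=
    exists_mem_Ioo_of_notMem_range (h0 ▸ hx.1.1) (hn ▸ hx.1.2) hx.2
  exact ((hd i hi).differentiableOn one_ne_zero).differentiableAt (Icc_mem_nhds hmem.1 hmem.2)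

lemma ae_differentiableAt (hc : PiecewiseC1 c) :
    ∀ᵐ x, x ∈ Set.Ioo (0 : ℝ) 1 → DifferentiableAt ℝ c x := by
  obtain ⟨s, hs, hd⟩ := hc.exists_countable_differentiableAt
  filter_upwards [hs.ae_notMem volume] with x hx h
  exact hd x ⟨h, hx⟩

lemma intervalIntegrable_length (hc : PiecewiseC1 c) {u : Plane → ℝ} (hu : ContDiff ℝ 1 u)
    (β : ℝ) :
    IntervalIntegrable
      (fun t => Real.sqrt (‖deriv c t‖ ^ 2 + β ^ 2 * (deriv (u ∘ c) t) ^ 2)) volume 0 1 := by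
  have h1 := hc.intervalIntegrable_deriv.norm.add
    ((hc.intervalIntegrable_deriv_comp hu).norm.const_mul |β|)
  refine h1.mono_fun ?_ (Eventually.of_forall fun t => ?_)
  · exact (((measurable_deriv c).norm.pow_const 2).add
      (((measurable_deriv (u ∘ c)).pow_const 2).const_mul (β ^ 2))).sqrt.aestronglyMeasurable
  · beta_reduce
    rw [Real.norm_of_nonneg (Real.sqrt_nonneg _)]
    refine le_trans ?_ (Real.le_norm_self _)
    refine Real.sqrt_le_iff.2 ⟨by positivity, ?_⟩
    have h2 : β ^ 2 * (deriv (u ∘ c) t) ^ 2 = (|β| * ‖deriv (u ∘ c) t‖) ^ 2 := by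
      rw [mul_pow, sq_abs, Real.norm_eq_abs, sq_abs]
    have h3 : 0 ≤ ‖deriv c t‖ * (|β| * ‖deriv (u ∘ c) t‖) := by positivity
    rw [h2]
    nlinarith

lemma dist_le_length (hc : PiecewiseC1 c) {u : Plane → ℝ} (hu : ContDiff ℝ 1 u) (β : ℝ)
    {x : ℝ} (hx : x ∈ Set.Icc (0 : ℝ) 1) :
    dist (c x) (c 0) ≤
      ∫ t in (0:ℝ)..1, Real.sqrt (‖deriv c t‖ ^ 2 + β ^ 2 * (deriv (u ∘ c) t) ^ 2) := by
  obtain ⟨s, hs, hd⟩ := hc.exists_countable_differentiableAt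
  have hsub : Set.uIcc 0 x ⊆ Set.uIcc (0 : ℝ) 1 := by
    rw [Set.uIcc_of_le hx.1, Set.uIcc_of_le zero_le_one]
    exact Set.Icc_subset_Icc_right hx.2
  have hi := hc.intervalIntegrable_deriv
  have h1 : ∫ t in (0:ℝ)..x, deriv c t = c x - c 0 := by
    refine integral_eq_of_hasDerivAt_off_countable c (deriv c) hs ?_ (fun y hy => ?_)
      (hi.mono_set hsub)
    · exact hc.1.mono (by rwa [Set.uIcc_of_le zero_le_one] at hsub)
    · rw [min_eq_left hx.1, max_eq_right hx.1] at hy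
      exact (hd y ⟨⟨hy.1.1, hy.1.2.trans_le hx.2⟩, hy.2⟩).hasDerivAt
  rw [dist_eq_norm, ← h1]
  calc ‖∫ t in (0:ℝ)..x, deriv c t‖ ≤ ∫ t in (0:ℝ)..x, ‖deriv c t‖ :=
        intervalIntegral.norm_integral_le_integral_norm hx.1
    _ ≤ ∫ t in (0:ℝ)..1, ‖deriv c t‖ :=
        intervalIntegral.integral_mono_interval le_rfl hx.1 hx.2
          (Eventually.of_forall fun t => norm_nonneg _) hi.norm
    _ ≤ _ := by
        refine intervalIntegral.integral_mono_on zero_le_one hi.norm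
          (hc.intervalIntegrable_length hu β) fun t _ => Real.le_sqrt_of_sq_le ?_
        have : 0 ≤ β ^ 2 * (deriv (u ∘ c) t) ^ 2 := by positivity
        linarith

/-- The variation of `u` along a curve staying where `‖∇u‖ ≤ M` is controlled by its length. -/
lemma abs_sub_mul_sqrt_le (hc : PiecewiseC1 c) {u : Plane → ℝ} (hu : ContDiff ℝ 1 u) (β : ℝ)
    {M : ℝ} (hM : 0 ≤ M) (hbound : ∀ x ∈ Set.Icc (0 : ℝ) 1, ‖fderiv ℝ u (c x)‖ ≤ M) :
    |u (c 1) - u (c 0)| * Real.sqrt (1 + β ^ 2 * M ^ 2) ≤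
      M * ∫ t in (0:ℝ)..1, Real.sqrt (‖deriv c t‖ ^ 2 + β ^ 2 * (deriv (u ∘ c) t) ^ 2) := by
  obtain ⟨s, hs, hd⟩ := hc.exists_countable_differentiableAt
  have hi := hc.intervalIntegrable_deriv_comp hu
  have hdiff : Differentiable ℝ u := hu.differentiable one_ne_zero
  have h1 : ∫ t in (0:ℝ)..1, deriv (u ∘ c) t = u (c 1) - u (c 0) := by
    refine integral_eq_of_hasDerivAt_off_countable (u ∘ c) (deriv (u ∘ c)) hs ?_ (fun y hy => ?_) hi
    · rw [Set.uIcc_of_le zero_le_one]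
      exact hu.continuous.comp_continuousOn hc.1
    · rw [min_eq_left zero_le_one, max_eq_right zero_le_one] at hy
      exact ((hdiff _).comp y (hd y hy)).hasDerivAt
  rw [← h1, ← Real.norm_eq_abs]
  calc ‖∫ t in (0:ℝ)..1, deriv (u ∘ c) t‖ * Real.sqrt (1 + β ^ 2 * M ^ 2)
      ≤ (∫ t in (0:ℝ)..1, ‖deriv (u ∘ c) t‖) * Real.sqrt (1 + β ^ 2 * M ^ 2) := by
        gcongr
        exact intervalIntegral.norm_integral_le_integral_norm zero_le_one
    _ = ∫ t in (0:ℝ)..1, ‖deriv (u ∘ c) t‖ * Real.sqrt (1 + β ^ 2 * M ^ 2) :=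
        (intervalIntegral.integral_mul_const _ _).symm
    _ ≤ ∫ t in (0:ℝ)..1, M * Real.sqrt (‖deriv c t‖ ^ 2 + β ^ 2 * (deriv (u ∘ c) t) ^ 2) := by
        refine intervalIntegral.integral_mono_ae_restrict zero_le_one (hi.norm.mul_const _)
          ((hc.intervalIntegrable_length hu β).const_mul M) ?_
        rw [← restrict_Ioo_eq_restrict_Icc, EventuallyLE,
          ae_restrict_iff' measurableSet_Ioo]
        filter_upwards [hc.ae_differentiableAt] with t ht hmem
        have hchain : deriv (u ∘ c) t = fderiv ℝ u (c t) (deriv c t) :=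
          fderiv_comp_deriv t (hdiff _) (ht hmem)
        have hle : ‖deriv (u ∘ c) t‖ ≤ M * ‖deriv c t‖ := by
          rw [hchain]
          exact (fderiv ℝ u (c t)).le_of_opNorm_le
            (hbound t (Set.Ioo_subset_Icc_self hmem)) _
        have hsq : ‖deriv (u ∘ c) t‖ ^ 2 ≤ M ^ 2 * ‖deriv c t‖ ^ 2 := by
          rw [← mul_pow]
          gcongr
        have habs : (deriv (u ∘ c) t) ^ 2 = ‖deriv (u ∘ c) t‖ ^ 2 := by
          rw [Real.norm_eq_abs, sq_abs]
        refine abs_le_of_sq_le_sq' ?_ (by positivity) |>.2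
        rw [mul_pow, mul_pow, Real.sq_sqrt (by positivity), Real.sq_sqrt (by positivity), habs]
        linarith
    _ = _ := intervalIntegral.integral_const_mul _ _

end PiecewiseC1

lemma piecewiseC1_of_contDiff {c : ℝ → Plane} (hc : ContDiff ℝ 1 c) : PiecewiseC1 c :=
  ⟨hc.continuous.continuousOn, 1, fun i => (i : ℝ), by simp, by simp, by simp,
    fun _ _ => hc.contDiffOn⟩

/-- Distance bound obtained from the straight segment. -/
lemma amoebaDistE_add_le {u : Plane → ℝ} (hu : ContDiff ℝ 1 u) (β : ℝ) (p v : Plane) {M : ℝ}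
    (hbound : ∀ y ∈ Metric.closedBall p ‖v‖, ‖fderiv ℝ u y‖ ≤ M) :
    amoebaDistE β u p (p + v) ≤ ‖v‖ * Real.sqrt (1 + β ^ 2 * M ^ 2) := by
  have hderiv : ∀ t : ℝ, HasDerivAt (fun s : ℝ => p + s • v) v t := fun t => by
    simpa using ((hasDerivAt_id t).smul_const v).const_add p
  have hc : PiecewiseC1 (fun s : ℝ => p + s • v) :=
    piecewiseC1_of_contDiff (by fun_prop)
  have hle : amoebaDistE β u p (p + v) ≤ ∫ t in (0:ℝ)..1,
      Real.sqrt (‖deriv (fun s : ℝ => p + s • v) t‖ ^ 2 +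
        β ^ 2 * (deriv (u ∘ fun s : ℝ => p + s • v) t) ^ 2) := by
    refine csInf_le ⟨0, ?_⟩ ⟨_, hc, by simp, by simp, rfl⟩
    rintro _ ⟨c, -, -, -, rfl⟩
    exact intervalIntegral.integral_nonneg zero_le_one fun t _ => Real.sqrt_nonneg _
  refine hle.trans ?_
  calc _ ≤ ∫ t in (0:ℝ)..1, ‖v‖ * Real.sqrt (1 + β ^ 2 * M ^ 2) := by
        refine intervalIntegral.integral_mono_on zero_le_one (hc.intervalIntegrable_length hu β)
          intervalIntegrable_const fun t ht => ?_
        have hM := hbound (p + t • v) (by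
          rw [mem_closedBall_iff_norm, add_sub_cancel_left, norm_smul, Real.norm_of_nonneg ht.1]
          exact mul_le_of_le_one_left (norm_nonneg _) ht.2)
        have hchain : deriv (u ∘ fun s : ℝ => p + s • v) t = fderiv ℝ u (p + t • v) v := by
          rw [fderiv_comp_deriv t (hu.differentiable one_ne_zero _)
            (hderiv t).differentiableAt, (hderiv t).deriv]
        have hsq : (fderiv ℝ u (p + t • v) v) ^ 2 ≤ M ^ 2 * ‖v‖ ^ 2 := by
          rw [← sq_abs, ← Real.norm_eq_abs, ← mul_pow]
          gcongr
          exact (fderiv ℝ u (p + t • v)).le_of_opNorm_le hM v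
        rw [hchain, (hderiv t).deriv]
        refine Real.sqrt_le_iff.2 ⟨by positivity, ?_⟩
        rw [mul_pow, Real.sq_sqrt (by positivity)]
        have := mul_le_mul_of_nonneg_left hsq (sq_nonneg β)
        linarith
    _ = _ := by simp

/-- Variation of `u` on points at amoeba distance less than `r`. -/
lemma abs_sub_le_of_amoebaDistE_lt {u : Plane → ℝ} (hu : ContDiff ℝ 1 u) {β : ℝ} {p q : Plane}
    {M r : ℝ} (hM : 0 ≤ M) (hbound : ∀ y ∈ Metric.closedBall p r, ‖fderiv ℝ u y‖ ≤ M)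
    (hq : amoebaDistE β u p q < r) :
    |u q - u p| ≤ r * (M / Real.sqrt (1 + β ^ 2 * M ^ 2)) := by
  have hne : {L | ∃ c : ℝ → Plane, PiecewiseC1 c ∧ c 0 = p ∧ c 1 = q ∧
      L = ∫ t in (0:ℝ)..1,
        Real.sqrt (‖deriv c t‖ ^ 2 + β ^ 2 * (deriv (u ∘ c) t) ^ 2)}.Nonempty :=
    ⟨_, fun s : ℝ => p + s • (q - p), piecewiseC1_of_contDiff (by fun_prop), by simp, by simp, rfl⟩
  obtain ⟨_, ⟨c, hc, rfl, rfl, rfl⟩, hlt⟩ := exists_lt_of_csInf_lt hne hq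
  have h := hc.abs_sub_mul_sqrt_le hu β hM fun x hx =>
    hbound _ (Metric.mem_closedBall.2 ((hc.dist_le_length hu β hx).trans hlt.le))
  have hpos : 0 < Real.sqrt (1 + β ^ 2 * M ^ 2) := by positivity
  rw [← mul_div_assoc, le_div_iff₀ hpos]
  calc _ ≤ _ := h
    _ ≤ M * r := by gcongr
    _ = r * M := mul_comm _ _

lemma norm_gradient_eq_norm_fderiv (u : Plane → ℝ) (x : Plane) :
    ‖gradient u x‖ = ‖fderiv ℝ u x‖ := by
  simp [gradient]

lemma gradient_neg (u : Plane → ℝ) (x : Plane) : gradient (-u) x = -gradient u x := by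
  simp [gradient, fderiv_neg]

lemma amoebaE_neg (β : ℝ) (u : Plane → ℝ) (x : Plane) (ρ : ℝ) :
    amoebaE β (-u) x ρ = amoebaE β u x ρ := by
  have h : ∀ (c : ℝ → Plane) (t : ℝ), deriv ((-u) ∘ c) t = -deriv (u ∘ c) t := fun c t => by
    rw [← deriv.neg]
    rfl
  simp only [amoebaE, amoebaDistE, h, neg_sq]

lemma sSup_amoebaE_sub_isLittleO (u : Plane → ℝ) (hu : ContDiff ℝ 1 u) (x₀ : Plane)
    (hgrad : gradient u x₀ ≠ 0) (β : ℝ) :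
    (fun ρ : ℝ => sSup (u '' amoebaE β u x₀ ρ) - u x₀ -
        ρ * (‖gradient u x₀‖ / Real.sqrt (1 + β ^ 2 * ‖gradient u x₀‖ ^ 2)))
      =o[𝓝[>] 0] (fun ρ : ℝ => ρ) := by
  set g := gradient u x₀ with hg
  set G := ‖g‖ with hG
  have hGpos : 0 < G := norm_pos_iff.2 hgrad
  set h : ℝ := G / Real.sqrt (1 + β ^ 2 * G ^ 2) with hh
  refine isLittleO_iff.2 fun η hη => ?_
  have hsqrt : ∀ M : ℝ, Real.sqrt (1 + β ^ 2 * M ^ 2) ≠ 0 := fun M => by positivity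
  have hupper : ∀ᶠ ε in 𝓝[>] (0 : ℝ),
      (1 + ε) * ((G + ε) / Real.sqrt (1 + β ^ 2 * (G + ε) ^ 2)) < h + η := by
    have hcont : Continuous fun ε : ℝ =>
        (1 + ε) * ((G + ε) / Real.sqrt (1 + β ^ 2 * (G + ε) ^ 2)) :=
      (by fun_prop : Continuous fun ε : ℝ => 1 + ε).mul
        ((by fun_prop : Continuous fun ε : ℝ => G + ε).div (by fun_prop) fun ε => hsqrt _)
    exact ((hcont.tendsto 0).mono_left nhdsWithin_le_nhds).eventually_lt_const
      (by simpa [hh] using hη)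
  have hlower : ∀ᶠ ε in 𝓝[>] (0 : ℝ),
      h - η < (G - ε) / Real.sqrt (1 + β ^ 2 * (G + ε) ^ 2) := by
    have hcont : Continuous fun ε : ℝ => (G - ε) / Real.sqrt (1 + β ^ 2 * (G + ε) ^ 2) :=
      (by fun_prop : Continuous fun ε : ℝ => G - ε).div (by fun_prop) fun ε => hsqrt _
    exact ((hcont.tendsto 0).mono_left nhdsWithin_le_nhds).eventually_const_lt
      (by simpa [hh] using hη)
  obtain ⟨ε, ⟨hup, hlow⟩, hε : 0 < ε⟩ :=
    ((hupper.and hlower).and self_mem_nhdsWithin).exists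
  set M := G + ε with hM
  have hMpos : 0 < M := by positivity
  set S := Real.sqrt (1 + β ^ 2 * M ^ 2) with hS
  have hSpos : 0 < S := by positivity
  have hS1 : 1 ≤ S := by
    rw [hS]
    exact Real.one_le_sqrt.2 (le_add_of_nonneg_right (by positivity))
  have hbd : ∀ᶠ y in 𝓝 x₀, ‖fderiv ℝ u y‖ < M :=
    (hu.continuous_fderiv one_ne_zero).norm.continuousAt.eventually_lt_const (by
      beta_reduce
      rw [← norm_gradient_eq_norm_fderiv]
      exact lt_add_of_pos_right _ hε)
  have hlin : ∀ᶠ y in 𝓝 x₀, ‖u y - u x₀ - fderiv ℝ u x₀ (y - x₀)‖ ≤ ε * ‖y - x₀‖ :=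
    (hasFDerivAt_iff_isLittleO.1
      (hu.differentiable one_ne_zero x₀).hasFDerivAt).def hε
  obtain ⟨δ, hδ, hball⟩ := Metric.eventually_nhds_iff_ball.1 (hbd.and hlin)
  have hδ' : 0 < δ / (1 + ε) := by positivity
  filter_upwards [Ioo_mem_nhdsGT hδ'] with ρ hρ
  have hρ0 : 0 < ρ := hρ.1
  have hρδ : (1 + ε) * ρ < δ := by
    rw [mul_comm]
    exact (lt_div_iff₀ (by positivity)).1 hρ.2
  have hle : ∀ y ∈ amoebaE β u x₀ ρ, u y ≤ u x₀ + ρ * (h + η) := fun y hy => by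
    have h1 := abs_sub_le_of_amoebaDistE_lt hu hMpos.le (r := (1 + ε) * ρ)
      (fun z hz => (hball z (Metric.closedBall_subset_ball hρδ hz)).1.le)
      (lt_of_le_of_lt hy (by nlinarith))
    have h2 := le_abs_self (u y - u x₀)
    have h3 := mul_le_mul_of_nonneg_left hup.le hρ0.le
    have h4 : (1 + ε) * ρ * (M / S) = ρ * ((1 + ε) * (M / S)) := by ring
    linarith
  set v : Plane := (ρ / (S * G)) • g with hv
  have hvn : ‖v‖ = ρ / S := by
    rw [hv, norm_smul, Real.norm_of_nonneg (by positivity), ← hG]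
    field_simp
  have hvδ : ‖v‖ < δ := by
    rw [hvn]
    have := div_le_self hρ0.le hS1
    nlinarith
  have hmem : x₀ + v ∈ amoebaE β u x₀ ρ := by
    have h1 := amoebaDistE_add_le hu β x₀ v (M := M) fun z hz =>
      (hball z (Metric.closedBall_subset_ball hvδ hz)).1.le
    rw [hvn, ← hS, div_mul_cancel₀ _ hSpos.ne'] at h1
    exact h1
  have hge : u x₀ + ρ * (h - η) ≤ u (x₀ + v) := by
    have h1 := (hball (x₀ + v) (by simpa using hvδ)).2
    have h2 : fderiv ℝ u x₀ v = ρ / S * G := by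
      have h3 : fderiv ℝ u x₀ g = G ^ 2 := by
        rw [← InnerProductSpace.toDual_symm_apply (𝕜 := ℝ)]
        exact real_inner_self_eq_norm_sq g
      rw [hv, map_smul, h3, smul_eq_mul]
      field_simp
    rw [add_sub_cancel_left, h2, hvn, Real.norm_eq_abs] at h1
    have h4 := (abs_le.1 h1).1
    have h5 := mul_le_mul_of_nonneg_left hlow.le hρ0.le
    have h6 : ρ * ((G - ε) / S) = ρ / S * G - ε * (ρ / S) := by ring
    linarith
  have hsup_le : sSup (u '' amoebaE β u x₀ ρ) ≤ u x₀ + ρ * (h + η) :=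
    csSup_le ⟨_, _, hmem, rfl⟩ (Set.forall_mem_image.2 hle)
  have hle_sup : u (x₀ + v) ≤ sSup (u '' amoebaE β u x₀ ρ) :=
    le_csSup ⟨_, mem_upperBounds.2 (Set.forall_mem_image.2 hle)⟩ ⟨_, hmem, rfl⟩
  rw [Real.norm_eq_abs, Real.norm_of_nonneg hρ0.le, abs_le]
  constructor <;> nlinarith

/-- One step of amoeba dilation or erosion approximates a time step of size ρ of
the Hamilton–Jacobi-type PDE  u_t = ± |∇u| / √(1 + β²|∇u|²). -/
theorem amoeba_dilation_erosion_approximates_hamilton_jacobi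
    (u : Plane → ℝ) (hu : ContDiff ℝ 2 u) (x₀ : Plane)
    (hgrad : gradient u x₀ ≠ 0) (β : ℝ) (hβ : 0 < β) :
    ((fun ρ : ℝ => sSup (u '' amoebaE β u x₀ ρ) - u x₀ -
        ρ * (‖gradient u x₀‖ / Real.sqrt (1 + β ^ 2 * ‖gradient u x₀‖ ^ 2)))
      =o[𝓝[>] 0] (fun ρ : ℝ => ρ)) ∧
    ((fun ρ : ℝ => sInf (u '' amoebaE β u x₀ ρ) - u x₀ +
        ρ * (‖gradient u x₀‖ / Real.sqrt (1 + β ^ 2 * ‖gradient u x₀‖ ^ 2)))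
      =o[𝓝[>] 0] (fun ρ : ℝ => ρ)) := by
  have hu1 : ContDiff ℝ 1 u := hu.of_le one_le_two
  refine ⟨sSup_amoebaE_sub_isLittleO u hu1 x₀ hgrad β, ?_⟩
  have hneg := (sSup_amoebaE_sub_isLittleO (-u) hu1.neg x₀
    (by rwa [gradient_neg, neg_ne_zero]) β).neg_left
  refine hneg.congr_left fun ρ => ?_
  have himage : (-u) '' amoebaE β u x₀ ρ = -(u '' amoebaE β u x₀ ρ) := by
    rw [← Set.image_neg_eq_neg, Set.image_image]
    rfl
  rw [amoebaE_neg, gradient_neg, norm_neg, himage, Real.sInf_def, Pi.neg_apply]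
  ring
end
end
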